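/- There exists a constant C > 0 such that for all natural numbers k₁, k₂ and all functions f ∈ ℋ_{k₁} and g ∈ ℋ_{k₂}, one has ‖f·g‖_{L²(S²)} ≤ C · min(1+k₁, 1+k₂)^{1/4} · ‖f‖_{L²(S²)} · ‖g‖_{L²(S²)}. -/

import Mathlib

open MeasureTheory Metric MvPolynomial

/-- The standard surface measure on the unit sphere `S² ⊆ ℝ³`. -/
noncomputable def sphereMeasure : Measure (sphere (0 : EuclideanSpace ℝ (Fin 3)) 1) :=
  (volume : Measure (EuclideanSpace ℝ (Fin 3))).toSphere

/-- `f : S² → ℂ` belongs to `ℋ_k`, i.e. it is the restriction to the unit sphere of a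
complex-valued polynomial on `ℝ³` that is homogeneous of degree `k` and harmonic. -/
def IsSphericalHarmonic (k : ℕ) (f : sphere (0 : EuclideanSpace ℝ (Fin 3)) 1 → ℂ) : Prop :=
  ∃ P : MvPolynomial (Fin 3) ℂ,
    P.IsHomogeneous k ∧
    (∑ i : Fin 3, pderiv i (pderiv i P)) = 0 ∧
    ∀ x : sphere (0 : EuclideanSpace ℝ (Fin 3)) 1,
      f x = MvPolynomial.eval (fun i => ((x : EuclideanSpace ℝ (Fin 3)) i : ℂ)) P

local notation "E3" => EuclideanSpace ℝ (Fin 3)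

local notation "S2" => sphere (0 : EuclideanSpace ℝ (Fin 3)) 1

/-- The moments of the Gaussian weight `exp (-t²)` on the line. -/
noncomputable def gaussMoment (n : ℕ) : ℝ := ∫ t : ℝ, t ^ n * Real.exp (-t ^ 2)

lemma integrable_pow_mul_gauss (n : ℕ) :
    Integrable fun t : ℝ => t ^ n * Real.exp (-t ^ 2) := by
  have h := integrable_rpow_mul_exp_neg_mul_sq (b := 1) one_pos (s := n)
    (by have : (0 : ℝ) ≤ n := n.cast_nonneg
        linarith)
  simpa using h

lemma gaussMoment_succ (n : ℕ) : gaussMoment (n + 1) = n / 2 * gaussMoment (n - 1) := by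
  have h := integral_mul_deriv_eq_deriv_mul_of_integrable (u := fun t : ℝ => t ^ n)
    (v := fun t : ℝ => Real.exp (-t ^ 2)) (u' := fun t => n * t ^ (n - 1))
    (v' := fun t => Real.exp (-t ^ 2) * (-(2 * t)))
    (fun t _ => by simpa using hasDerivAt_pow n t)
    (fun t _ => by simpa using ((hasDerivAt_pow 2 t).neg).exp)
    (((integrable_pow_mul_gauss (n + 1)).const_mul (-2)).congr
      (ae_of_all _ fun t => by simp only [Pi.mul_apply]; ring))
    (((integrable_pow_mul_gauss (n - 1)).const_mul n).congr
      (ae_of_all _ fun t => by simp only [Pi.mul_apply]; ring))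
    (integrable_pow_mul_gauss n)
  have h1 : ∫ t : ℝ, t ^ n * (Real.exp (-t ^ 2) * (-(2 * t))) = -2 * gaussMoment (n + 1) := by
    rw [gaussMoment, ← integral_const_mul]
    congr 1; ext t; ring
  have h2 : ∫ t : ℝ, n * t ^ (n - 1) * Real.exp (-t ^ 2) = n * gaussMoment (n - 1) := by
    rw [gaussMoment, ← integral_const_mul]
    congr 1; ext t; ring
  rw [h1, h2] at h
  linarith

/-- The radial moments of the Gaussian weight on `ℝ³`. -/
noncomputable def radialMoment (p : ℕ) : ℝ :=
  ∫ r in Set.Ioi (0 : ℝ), r ^ 2 * (r ^ p * Real.exp (-r ^ 2))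

lemma radialMoment_eq (p : ℕ) : radialMoment p = 1 / 2 * Real.Gamma ((p + 3) / 2) := by
  have h := integral_rpow_mul_exp_neg_rpow (p := 2) (q := p + 2) two_pos (by
    have : (0 : ℝ) ≤ p := p.cast_nonneg
    linarith)
  rw [show ((p : ℝ) + 3) / 2 = (p + 2 + 1) / 2 by ring, ← h, radialMoment]
  refine setIntegral_congr_fun measurableSet_Ioi fun r hr => ?_
  have h3 : r ^ ((p : ℝ) + 2) = r ^ 2 * r ^ p := by
    rw [show (p : ℝ) + 2 = ((p + 2 : ℕ) : ℝ) by push_cast; ring, Real.rpow_natCast]; ring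
  simp only [h3, Real.rpow_two]
  ring

lemma radialMoment_pos (p : ℕ) : 0 < radialMoment p := by
  rw [radialMoment_eq]
  have := Real.Gamma_pos_of_pos (s := ((p : ℝ) + 3) / 2) (by positivity)
  positivity

lemma radialMoment_add_two (p : ℕ) :
    radialMoment (p + 2) = (p + 3) / 2 * radialMoment p := by
  rw [radialMoment_eq, radialMoment_eq]
  have : ((p + 2 : ℕ) + 3 : ℝ) / 2 = (p + 3) / 2 + 1 := by push_cast; ring
  rw [this, Real.Gamma_add_one (by positivity)]
  ring

lemma integral_sphere_monomial_mul_radialMoment (d : Fin 3 → ℕ) :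
    (∫ x, ∏ i, (x : E3) i ^ d i ∂sphereMeasure) * radialMoment (∑ i, d i) =
      ∏ i, gaussMoment (d i) := by
  let μ : Measure E3 := volume
  let F : E3 → ℝ := fun x => (∏ i, x i ^ d i) * Real.exp (-‖x‖ ^ 2)
  have hdim : Module.finrank ℝ E3 - 1 = 2 := by simp 
  have h1 : ∫ x, F x = ∏ i, gaussMoment (d i) := by
    rw [← (PiLp.volume_preserving_toLp (Fin 3)).integral_comp
      (MeasurableEquiv.toLp 2 (Fin 3 → ℝ)).measurableEmbedding F]
    simp only [gaussMoment]
    rw [← integral_fintype_prod_eq_prod (𝕜 := ℝ) fun i t => t ^ d i * Real.exp (-t ^ 2)]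
    refine integral_congr_ae (ae_of_all _ fun y => ?_)
    simp [F, EuclideanSpace.norm_sq_eq, Finset.prod_mul_distrib, ← Real.exp_sum,
      Finset.sum_neg_distrib]
  have h2 : ∫ x, F x = (∫ x, ∏ i, (x : E3) i ^ d i ∂sphereMeasure) * radialMoment (∑ i, d i) := by
    calc ∫ x, F x = ∫ x : ({(0)}ᶜ : Set E3), F x.1 ∂(μ.comap (↑)) := by
          rw [integral_subtype_comap (measurableSet_singleton _).compl F,
            restrict_compl_singleton]
      _ = ∫ x, (∏ i, (x.1 : E3) i ^ d i) * (x.2.1 ^ (∑ i, d i) * Real.exp (-x.2.1 ^ 2))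
            ∂μ.toSphere.prod (.volumeIoiPow (Module.finrank ℝ E3 - 1)) := by
          rw [← μ.measurePreserving_homeomorphUnitSphereProd.integral_comp
            (Homeomorph.measurableEmbedding _)]
          refine integral_congr_ae (ae_of_all _ fun x => ?_)
          have hx : ‖(x : E3)‖ ≠ 0 := norm_ne_zero_iff.2 x.2
          simp only [F, homeomorphUnitSphereProd_apply_snd_coe,
            homeomorphUnitSphereProd_apply_fst_coe, PiLp.smul_apply, smul_eq_mul, mul_pow,
            Finset.prod_mul_distrib, inv_pow, Finset.prod_inv_distrib]
          have := Finset.prod_ne_zero_iff.2 fun i (_ : i ∈ Finset.univ) => pow_ne_zero (d i) hx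
          rw [← Finset.prod_pow_eq_pow_sum]
          field_simp
      _ = _ := by
          rw [integral_prod_mul (fun x : sphere (0 : E3) 1 => ∏ i, (x : E3) i ^ d i)
            (fun r : Set.Ioi (0 : ℝ) => r.1 ^ (∑ i, d i) * Real.exp (-r.1 ^ 2)), sphereMeasure]
          congr 1
          simp only [Measure.volumeIoiPow, ENNReal.ofReal, hdim]
          rw [integral_withDensity_eq_integral_smul,
            integral_subtype_comap measurableSet_Ioi fun a : ℝ ↦
              Real.toNNReal (a ^ 2) • (a ^ (∑ i, d i) * Real.exp (-a ^ 2)),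
            radialMoment, setIntegral_congr_fun measurableSet_Ioi fun x hx ↦ ?_]
          · rw [NNReal.smul_def, Real.coe_toNNReal _ (by positivity), smul_eq_mul]
          · exact (measurable_subtype_coe.pow_const _).real_toNNReal
  rw [← h2, h1]

/-- The Legendre polynomials. -/
noncomputable def legendreP : ℕ → ℝ → ℝ
  | 0, _ => 1
  | 1, t => t
  | n + 2, t => ((2 * n + 3) * (t * legendreP (n + 1) t) - (n + 1) * legendreP n t) / (n + 2)

lemma mul_legendreP (k : ℕ) (t : ℝ) :
    (2 * k + 1) * (t * legendreP k t) =
      (k + 1) * legendreP (k + 1) t + k * legendreP (k - 1) t := by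
  rcases k with _ | k
  · simp [legendreP]
  · rw [show k + 1 + 1 = k + 2 from rfl, legendreP, Nat.add_sub_cancel]
    push_cast
    field_simp
    ring

/-- The coefficients `(2n choose n) / 4ⁿ`, extended by zero to negative integers. -/
noncomputable def wallis (n : ℤ) : ℝ :=
  if 0 ≤ n then (n.toNat.centralBinom : ℝ) / 4 ^ n.toNat else 0

lemma wallis_of_neg {n : ℤ} (hn : n < 0) : wallis n = 0 := if_neg (not_le.2 hn)

lemma wallis_natCast (n : ℕ) : wallis n = (n.centralBinom : ℝ) / 4 ^ n := by simp [wallis]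

lemma wallis_nonneg (n : ℤ) : 0 ≤ wallis n := by
  unfold wallis; split_ifs <;> positivity

lemma wallis_pos {n : ℤ} (hn : 0 ≤ n) : 0 < wallis n := by
  rw [wallis, if_pos hn]
  have := n.toNat.centralBinom_pos
  positivity

lemma wallis_zero : wallis 0 = 1 := by simp [wallis]

lemma wallis_succ (n : ℤ) : (2 * n + 2) * wallis (n + 1) = (2 * n + 1) * wallis n := by
  rcases lt_trichotomy n (-1) with h | rfl | h
  · rw [wallis_of_neg (by omega), wallis_of_neg (by omega)]; simp
  · rw [wallis_of_neg (n := -1) (by omega)]; simp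
  · obtain ⟨m, rfl⟩ := Int.eq_ofNat_of_zero_le (show 0 ≤ n by omega)
    have h1 : wallis ((m : ℤ) + 1) = ((m + 1).centralBinom : ℝ) / 4 ^ (m + 1) := by
      rw [← wallis_natCast]; push_cast; rfl
    have h2 : ((m : ℝ) + 1) * (m + 1).centralBinom = 2 * (2 * m + 1) * m.centralBinom := by
      exact_mod_cast Nat.succ_mul_centralBinom_succ m
    rw [h1, wallis_natCast, pow_succ]
    push_cast
    field_simp
    linear_combination 2 * h2

lemma two_mul_add_one_ne_zero_int (n : ℤ) : (2 * n + 1 : ℝ) ≠ 0 := by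
  have : 2 * n + 1 ≠ 0 := by omega
  exact_mod_cast this

lemma wallis_eq (n : ℤ) : wallis n = wallis (n + 1) * ((2 * n + 2) / (2 * n + 1)) := by
  have := two_mul_add_one_ne_zero_int n
  have h := wallis_succ n
  field_simp
  linear_combination -h

/-- Half of the integral over `[-1, 1]` of the product of three Legendre polynomials. -/
noncomputable def legendreTriple (k l j : ℤ) : ℝ :=
  if Even (k + l + j) then
    wallis ((k + l + j) / 2 - k) * wallis ((k + l + j) / 2 - l) * wallis ((k + l + j) / 2 - j) /
      (wallis ((k + l + j) / 2) * (2 * ((k + l + j) / 2 : ℤ) + 1))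
  else 0

lemma legendreTriple_eq {k l j g : ℤ} (h : k + l + j = 2 * g) :
    legendreTriple k l j =
      wallis (g - k) * wallis (g - l) * wallis (g - j) / (wallis g * (2 * g + 1)) := by
  rw [legendreTriple, if_pos (by rw [h]; exact even_two_mul g), h,
    Int.mul_ediv_cancel_left g two_ne_zero]

lemma legendreTriple_of_odd {k l j : ℤ} (h : Odd (k + l + j)) : legendreTriple k l j = 0 :=
  if_neg (Int.not_even_iff_odd.2 h)

lemma legendreTriple_eq_zero {k l j : ℤ} (h : k + l < j) : legendreTriple k l j = 0 := by
  rcases Int.even_or_odd' (k + l + j) with ⟨g, hg | hg⟩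
  · rw [legendreTriple_eq hg, wallis_of_neg (n := g - j) (by omega)]; simp
  · exact legendreTriple_of_odd ⟨g, hg⟩

lemma legendreTriple_nonneg (k l j : ℕ) : 0 ≤ legendreTriple k l j := by
  rcases Int.even_or_odd' ((k : ℤ) + l + j) with ⟨g, hg | hg⟩
  · rw [legendreTriple_eq hg]
    have : 0 ≤ g := by omega
    have : (0 : ℝ) ≤ g := by exact_mod_cast this
    have h1 := wallis_nonneg (g - k)
    have h2 := wallis_nonneg (g - l)
    have h3 := wallis_nonneg (g - j)
    have h4 := wallis_nonneg g
    positivity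
  · rw [legendreTriple_of_odd ⟨g, hg⟩]

lemma legendreTriple_zero_left (l j : ℕ) :
    (2 * j + 1) * legendreTriple 0 l j = if j = l then 1 else 0 := by
  split_ifs with h
  · subst h
    rw [legendreTriple_eq (show (0 : ℤ) + j + j = 2 * j by ring)]
    have := wallis_pos (Int.natCast_nonneg j)
    simp only [sub_zero, sub_self, wallis_zero]
    push_cast
    field_simp
  · rcases Int.even_or_odd' (0 + (l : ℤ) + j) with ⟨g, hg | hg⟩
    · rw [legendreTriple_eq hg]
      rcases lt_or_gt_of_ne h with h | h
      · rw [wallis_of_neg (n := g - l) (by omega)]; simp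
      · rw [wallis_of_neg (n := g - j) (by omega)]; simp
    · rw [legendreTriple_of_odd ⟨g, hg⟩, mul_zero]

lemma legendreTriple_recurrence {k l j : ℤ} (hk : 0 ≤ k + l + j) :
    (2 * k + 1) * (j * legendreTriple k l (j - 1) + (j + 1) * legendreTriple k l (j + 1)) =
      (2 * j + 1) * ((k + 1) * legendreTriple (k + 1) l j + k * legendreTriple (k - 1) l j) := by
  rcases Int.even_or_odd' (k + l + j) with ⟨g, hg | hg⟩
  · rw [legendreTriple_of_odd (show Odd (k + l + (j - 1)) from ⟨g - 1, by omega⟩),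
      legendreTriple_of_odd (show Odd (k + l + (j + 1)) from ⟨g, by omega⟩),
      legendreTriple_of_odd (show Odd (k + 1 + l + j) from ⟨g, by omega⟩),
      legendreTriple_of_odd (show Odd (k - 1 + l + j) from ⟨g - 1, by omega⟩)]
    simp
  · have hg0 : 0 ≤ g := by omega
    have hw := wallis_pos (show 0 ≤ g + 1 by omega)
    rw [legendreTriple_eq (show k + l + (j - 1) = 2 * g by omega),
      legendreTriple_eq (show k + l + (j + 1) = 2 * (g + 1) by omega),
      legendreTriple_eq (show k + 1 + l + j = 2 * (g + 1) by omega),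
      legendreTriple_eq (show k - 1 + l + j = 2 * g by omega)]
    rw [show g - (j - 1) = g - j + 1 by ring, show g + 1 - k = g - k + 1 by ring,
      show g + 1 - l = g - l + 1 by ring, show g + 1 - (j + 1) = g - j by ring,
      show g + 1 - (k + 1) = g - k by ring, show g + 1 - j = g - j + 1 by ring,
      show g - (k - 1) = g - k + 1 by ring,
      wallis_eq (g - k), wallis_eq (g - l), wallis_eq (g - j), wallis_eq g]
    have hu := two_mul_add_one_ne_zero_int (g - k)
    have hv := two_mul_add_one_ne_zero_int (g - l)
    have hz := two_mul_add_one_ne_zero_int (g - j)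
    have hg1 := two_mul_add_one_ne_zero_int g
    have hg2 : (2 * g + 2 : ℝ) ≠ 0 := by
      have : 2 * g + 2 ≠ 0 := by omega
      exact_mod_cast this
    have hg3 := two_mul_add_one_ne_zero_int (g + 1)
    generalize wallis (g - k + 1) = x
    generalize wallis (g - l + 1) = y
    generalize wallis (g - j + 1) = z
    have hl : (l : ℝ) = 2 * g + 1 - k - j := by
      have : l = 2 * g + 1 - k - j := by omega
      exact_mod_cast this
    push_cast at *
    rw [hl] at hv ⊢
    generalize wallis (g + 1) = w at *
    have hw' := hw.ne'
    field_simp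
    ring

lemma legendreP_mul_step {t : ℝ} {k l : ℕ}
    (h0 : ∀ N, k + l < N → legendreP k t * legendreP l t =
      ∑ j ∈ Finset.range N, (2 * j + 1) * legendreTriple k l j * legendreP j t)
    (h1 : ∀ N, k + l < N → k * (legendreP (k - 1) t * legendreP l t) =
      k * ∑ j ∈ Finset.range N, (2 * j + 1) * legendreTriple (k - 1) l j * legendreP j t)
    {N : ℕ} (hN : k + 1 + l < N) : legendreP (k + 1) t * legendreP l t =
      ∑ j ∈ Finset.range N, (2 * j + 1) * legendreTriple (k + 1) l j * legendreP j t := by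
  have hk : (k + 1 : ℝ) ≠ 0 := by positivity
  refine mul_left_cancel₀ hk ?_
  have e1 : (k + 1 : ℝ) * (legendreP (k + 1) t * legendreP l t) =
      (2 * k + 1) * (t * (legendreP k t * legendreP l t)) -
        k * (legendreP (k - 1) t * legendreP l t) := by
    linear_combination -legendreP l t * mul_legendreP k t
  rw [e1, h0 N (by omega), h1 N (by omega)]
  have e2 : t * ∑ j ∈ Finset.range N, (2 * j + 1) * legendreTriple k l j * legendreP j t =
      ∑ j ∈ Finset.range N, legendreTriple k l j * ((j + 1) * legendreP (j + 1) t) +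
      ∑ j ∈ Finset.range N, legendreTriple k l j * (j * legendreP (j - 1) t) := by
    rw [Finset.mul_sum, ← Finset.sum_add_distrib]
    refine Finset.sum_congr rfl fun j _ => ?_
    linear_combination legendreTriple k l j * mul_legendreP j t
  obtain ⟨M, rfl⟩ : ∃ M, N = M + 1 := ⟨N - 1, by omega⟩
  have e3 : ∑ j ∈ Finset.range (M + 1), legendreTriple k l j * ((j + 1) * legendreP (j + 1) t) =
      ∑ j ∈ Finset.range (M + 1), legendreTriple k l (j - 1) * (j * legendreP j t) := by
    rw [Finset.sum_range_succ, Finset.sum_range_succ', legendreTriple_eq_zero (by omega)]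
    simp
  have e4 : ∑ j ∈ Finset.range (M + 1), legendreTriple k l j * (j * legendreP (j - 1) t) =
      ∑ j ∈ Finset.range (M + 1), legendreTriple k l (j + 1) * ((j + 1) * legendreP j t) := by
    rw [Finset.sum_range_succ', Finset.sum_range_succ,
      legendreTriple_eq_zero (j := (M : ℤ) + 1) (by omega)]
    simp
  rw [e2, e3, e4, ← Finset.sum_add_distrib, Finset.mul_sum, Finset.mul_sum, Finset.mul_sum,
    ← Finset.sum_sub_distrib]
  refine Finset.sum_congr rfl fun j _ => ?_
  have := legendreTriple_recurrence (show 0 ≤ (k : ℤ) + l + j by omega)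
  push_cast at this
  linear_combination legendreP j t * this

/-- Adams' formula for the product of two Legendre polynomials. -/
lemma legendreP_mul (t : ℝ) (k l : ℕ) {N : ℕ} (hN : k + l < N) :
    legendreP k t * legendreP l t =
      ∑ j ∈ Finset.range N, (2 * j + 1) * legendreTriple k l j * legendreP j t := by
  have h0 : ∀ N, l < N → legendreP 0 t * legendreP l t =
      ∑ j ∈ Finset.range N, (2 * j + 1) * legendreTriple 0 l j * legendreP j t := by
    intro N hN
    simp only [legendreTriple_zero_left, ite_mul, one_mul, zero_mul]
    rw [Finset.sum_ite_eq' (Finset.range N) l, if_pos (Finset.mem_range.2 hN)]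
    simp [legendreP]
  induction k using Nat.twoStepInduction generalizing N with
  | zero => exact_mod_cast h0 N (by omega)
  | one =>
    have := legendreP_mul_step (t := t) (k := 0) (l := l)
      (fun N hN => by exact_mod_cast h0 N (by omega))
      (fun N hN => by simp) hN
    simpa using this
  | more k ih0 ih1 =>
    have := legendreP_mul_step (t := t) (k := k + 1) (l := l) (fun N hN => ih1 hN)
      (fun N hN => by
        congr 1
        have := @ih0 N (by omega)
        simpa using this) hN
    rw [this]
    push_cast
    simp only [add_assoc, one_add_one_eq_two]

instance : IsFiniteMeasure sphereMeasure := by unfold sphereMeasure; infer_instance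

/-- Restriction of a complex polynomial on `ℝ³` to the unit sphere. -/
noncomputable def sphereRestrict : MvPolynomial (Fin 3) ℂ →ₐ[ℂ] C(S2, ℂ) :=
  aeval fun i => ⟨fun x => (((x : E3) i : ℝ) : ℂ), by fun_prop⟩

lemma sphereRestrict_apply (P : MvPolynomial (Fin 3) ℂ) (x : S2) :
    sphereRestrict P x = eval (fun i => (((x : E3) i : ℝ) : ℂ)) P := by
  induction P using MvPolynomial.induction_on with
  | C a => simp [sphereRestrict]
  | add p q hp hq => simp [hp, hq]
  | mul_X p i hp => rw [map_mul, map_mul, ContinuousMap.mul_apply, hp]; simp [sphereRestrict]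

lemma ContinuousMap.integrable_sphere (f : C(S2, ℂ)) : Integrable f sphereMeasure :=
  f.continuous.integrable_of_hasCompactSupport (HasCompactSupport.of_compactSpace f)

/-- The integral over the sphere of the restriction of a polynomial. -/
noncomputable def sphereIntegral : MvPolynomial (Fin 3) ℂ →ₗ[ℂ] ℂ where
  toFun P := ∫ x, sphereRestrict P x ∂sphereMeasure
  map_add' P Q := by
    simp only [map_add, ContinuousMap.add_apply]
    exact integral_add (ContinuousMap.integrable_sphere _) (ContinuousMap.integrable_sphere _)
  map_smul' c P := by
    simp only [map_smul, ContinuousMap.smul_apply, RingHom.id_apply]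
    exact integral_smul _ _

lemma sphereIntegral_apply (P : MvPolynomial (Fin 3) ℂ) :
    sphereIntegral P = ∫ x, sphereRestrict P x ∂sphereMeasure := rfl

lemma sphereIntegral_monomial (d : Fin 3 →₀ ℕ) :
    sphereIntegral (monomial d 1) =
      (((∏ i, gaussMoment (d i)) / radialMoment d.degree : ℝ) : ℂ) := by
  have h := integral_sphere_monomial_mul_radialMoment d
  rw [← eq_div_iff (radialMoment_pos _).ne'] at h
  rw [Finsupp.degree_eq_sum, ← h, sphereIntegral_apply, ← integral_complex_ofReal]
  congr 1; ext x
  simp [sphereRestrict_apply, eval_monomial, Finsupp.prod_fintype]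

lemma sphereIntegral_pderiv_monomial (i : Fin 3) (d : Fin 3 →₀ ℕ) :
    sphereIntegral (pderiv i (monomial d 1)) =
      (d.degree + 2) * sphereIntegral (X i * monomial d 1) := by
  have e1 : (X i * monomial d 1 : MvPolynomial (Fin 3) ℂ) =
      monomial (d + Finsupp.single i 1) 1 := by
    rw [X, monomial_mul, add_comm, one_mul]
  have e2 : pderiv i (monomial d (1 : ℂ)) = (d i : ℂ) • monomial (d - Finsupp.single i 1) 1 := by
    rw [pderiv_monomial, smul_monomial]; simp
  rw [e1, e2, map_smul, sphereIntegral_monomial, sphereIntegral_monomial]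
  have p1 : ∏ j, gaussMoment ((d + Finsupp.single i 1 : Fin 3 →₀ ℕ) j) =
      gaussMoment (d i + 1) * ∏ j ∈ Finset.univ.erase i, gaussMoment (d j) := by
    rw [← Finset.mul_prod_erase _ _ (Finset.mem_univ i)]
    congr 1
    · simp
    · refine Finset.prod_congr rfl fun j hj => ?_
      simp [(Finset.ne_of_mem_erase hj).symm]
  have p2 : ∏ j, gaussMoment ((d - Finsupp.single i 1 : Fin 3 →₀ ℕ) j) =
      gaussMoment (d i - 1) * ∏ j ∈ Finset.univ.erase i, gaussMoment (d j) := by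
    rw [← Finset.mul_prod_erase _ _ (Finset.mem_univ i)]
    congr 1
    · simp
    · refine Finset.prod_congr rfl fun j hj => ?_
      simp [(Finset.ne_of_mem_erase hj).symm]
  rw [p1, p2, gaussMoment_succ]
  rcases Nat.eq_zero_or_pos (d i) with h0 | h0
  · simp [h0]
  have hle : Finsupp.single i 1 ≤ d := Finsupp.single_le_iff.2 h0
  obtain ⟨e, rfl⟩ := exists_add_of_le hle
  have hd : radialMoment (Finsupp.single i 1 + e + Finsupp.single i 1).degree =
      (e.degree + 3) / 2 * radialMoment e.degree := by
    rw [← radialMoment_add_two]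
    congr 1
    simp only [map_add, Finsupp.degree_single]; ring
  rw [hd, add_tsub_cancel_left, map_add, Finsupp.degree_single]
  have := (radialMoment_pos e.degree).ne'
  have h3 : (e.degree : ℝ) + 3 ≠ 0 := by positivity
  rw [smul_eq_mul, ← Complex.ofReal_natCast, ← Complex.ofReal_natCast]
  norm_cast
  push_cast
  have : (1 + e.degree + 2 : ℝ) ≠ 0 := by positivity
  field_simp
  ring

/-- Integration by parts on the sphere for homogeneous polynomials. -/
lemma sphereIntegral_pderiv {p : ℕ} {P : MvPolynomial (Fin 3) ℂ} (hP : P.IsHomogeneous p)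
    (i : Fin 3) : sphereIntegral (pderiv i P) = (p + 2) * sphereIntegral (X i * P) := by
  conv_lhs => rw [P.as_sum]
  conv_rhs => rw [P.as_sum]
  rw [map_sum, map_sum, Finset.mul_sum, map_sum, Finset.mul_sum]
  refine Finset.sum_congr rfl fun d hd => ?_
  have hdeg : d.degree = p := by
    rw [Finsupp.degree_eq_weight_one]; exact hP (mem_support_iff.1 hd)
  have : monomial d (coeff d P) = coeff d P • monomial d (1 : ℂ) := by
    rw [smul_monomial]; simp
  rw [this, (pderiv i).map_smul, map_smul, mul_smul_comm, map_smul,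
    sphereIntegral_pderiv_monomial, hdeg, smul_eq_mul, smul_eq_mul]
  ring

/-- The Laplacian on complex polynomials in three variables. -/
noncomputable def polyLaplacian : MvPolynomial (Fin 3) ℂ →ₗ[ℂ] MvPolynomial (Fin 3) ℂ :=
  ∑ i, (pderiv i).toLinearMap ∘ₗ (pderiv i).toLinearMap

lemma polyLaplacian_apply (P : MvPolynomial (Fin 3) ℂ) :
    polyLaplacian P = ∑ i, pderiv i (pderiv i P) := by
  simp [polyLaplacian]

/-- Harmonic homogeneous polynomials of degree `k`. -/
noncomputable def harmonicSubmodule (k : ℕ) : Submodule ℂ (MvPolynomial (Fin 3) ℂ) :=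
  homogeneousSubmodule (Fin 3) ℂ k ⊓ LinearMap.ker polyLaplacian

lemma pderiv_comm (i j : Fin 3) (P : MvPolynomial (Fin 3) ℂ) :
    pderiv i (pderiv j P) = pderiv j (pderiv i P) := by
  have h : ⁅pderiv (R := ℂ) i, pderiv (R := ℂ) j⁆ = 0 := by
    refine derivation_ext fun l => ?_
    rw [Derivation.commutator_apply]
    by_cases hi : i = l <;> by_cases hj : j = l <;> simp [pderiv_X, hi, hj]
  have := congrArg (fun D => D P) h
  simpa [Derivation.commutator_apply, sub_eq_zero] using this

lemma mem_harmonicSubmodule {k : ℕ} {P : MvPolynomial (Fin 3) ℂ} :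
    P ∈ harmonicSubmodule k ↔ P.IsHomogeneous k ∧ polyLaplacian P = 0 := by
  simp [harmonicSubmodule]

lemma sphereIntegral_grad_mul_grad {j k : ℕ} {P Q : MvPolynomial (Fin 3) ℂ}
    (hP : P ∈ harmonicSubmodule k) (hQ : Q.IsHomogeneous j) :
    sphereIntegral (∑ i, pderiv i Q * pderiv i P) = k * (j + k + 1) * sphereIntegral (Q * P) := by
  obtain ⟨hPh, hPl⟩ := mem_harmonicSubmodule.1 hP
  have h1 : ∑ i, pderiv i (Q * pderiv i P) = ∑ i, pderiv i Q * pderiv i P := by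
    rw [polyLaplacian_apply] at hPl
    simp only [pderiv_mul, Finset.sum_add_distrib, ← Finset.mul_sum, hPl, mul_zero, add_zero]
  have h2 : ∑ i, X i * (Q * pderiv i P) = (k : ℂ) • (Q * P) := by
    have := hPh.sum_X_mul_pderiv
    calc _ = Q * ∑ i, X i * pderiv i P := by rw [Finset.mul_sum]; congr 1; ext1 i; ring
      _ = _ := by rw [this, mul_smul_comm, Nat.cast_smul_eq_nsmul]
  rw [← h1, map_sum]
  simp_rw [fun i => sphereIntegral_pderiv (hQ.mul (hPh.pderiv (i := i))) i]
  rw [← Finset.mul_sum, ← map_sum, h2, map_smul]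
  rcases k with _ | k
  · simp
  · simp only [Nat.add_sub_cancel, smul_eq_mul]; push_cast; ring

/-- Harmonic homogeneous polynomials of different degrees are orthogonal on the sphere. -/
lemma sphereIntegral_mul_eq_zero {j k : ℕ} {P Q : MvPolynomial (Fin 3) ℂ}
    (hQ : Q ∈ harmonicSubmodule j) (hP : P ∈ harmonicSubmodule k) (hjk : j ≠ k) :
    sphereIntegral (Q * P) = 0 := by
  have h1 := sphereIntegral_grad_mul_grad hP (mem_harmonicSubmodule.1 hQ).1
  have h2 := sphereIntegral_grad_mul_grad hQ (mem_harmonicSubmodule.1 hP).1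
  have h3 : ∑ i, pderiv i P * pderiv i Q = ∑ i, pderiv i Q * pderiv i P := by
    congr 1; ext1 i; ring
  rw [h3, h1, mul_comm P Q] at h2
  have h4 : ((k : ℂ) - j) * (j + k + 1) * sphereIntegral (Q * P) = 0 := by linear_combination h2
  have h5 : (k : ℂ) - j ≠ 0 := sub_ne_zero.2 (by exact_mod_cast hjk.symm)
  have h6 : (j : ℂ) + k + 1 ≠ 0 := by exact_mod_cast Nat.succ_ne_zero (j + k)
  simpa [h5, h6] using h4

/-- The polynomial `|y|²`. -/
noncomputable def normSqPoly : MvPolynomial (Fin 3) ℂ := ∑ i, X i * X i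

/-- The linear form `y ↦ ∑ i, a i * y i`. -/
noncomputable def linForm (a : Fin 3 → ℂ) : MvPolynomial (Fin 3) ℂ := ∑ i, C (a i) * X i

/-- The derivative in the direction `a`. -/
noncomputable def dirDeriv (a : Fin 3 → ℂ) (P : MvPolynomial (Fin 3) ℂ) :
    MvPolynomial (Fin 3) ℂ := ∑ i, C (a i) * pderiv i P

/-- The zonal harmonic polynomial `|y|ᵏ Pₖ(a · y / |y|)`, where `Pₖ` is the Legendre polynomial. -/
noncomputable def zonalPoly (a : Fin 3 → ℂ) : ℕ → MvPolynomial (Fin 3) ℂ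
  | 0 => 1
  | 1 => linForm a
  | n + 2 => C ((2 * n + 3 : ℂ) / (n + 2)) * (linForm a * zonalPoly a (n + 1)) -
      C ((n + 1 : ℂ) / (n + 2)) * (normSqPoly * zonalPoly a n)

lemma linForm_mul_zonalPoly (a : Fin 3 → ℂ) (k : ℕ) :
    C (2 * k + 1 : ℂ) * (linForm a * zonalPoly a k) =
      C (k + 1 : ℂ) * zonalPoly a (k + 1) + C (k : ℂ) * (normSqPoly * zonalPoly a (k - 1)) := by
  rcases k with _ | k
  · simp [zonalPoly]
  · have h : (k : ℂ) + 2 ≠ 0 := by exact_mod_cast Nat.succ_ne_zero (k + 1)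
    rw [show k + 1 + 1 = k + 2 from rfl, zonalPoly, mul_sub, ← mul_assoc (C _) (C _),
      ← mul_assoc (C _) (C _), ← C_mul, ← C_mul]
    simp only [Nat.add_sub_cancel]
    rw [show ((k + 1 : ℕ) + 1 : ℂ) * ((2 * k + 3) / (k + 2)) = 2 * (k + 1 : ℕ) + 1 by
        push_cast; field_simp; ring,
      show ((k + 1 : ℕ) + 1 : ℂ) * ((k + 1) / (k + 2)) = (k + 1 : ℕ) by
        push_cast; field_simp; ring]
    ring

lemma isHomogeneous_linForm (a : Fin 3 → ℂ) : (linForm a).IsHomogeneous 1 :=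
  IsHomogeneous.sum _ _ _ fun i _ => by
    simpa using (isHomogeneous_C (Fin 3) (a i)).mul (isHomogeneous_X ℂ i)

lemma isHomogeneous_normSqPoly : normSqPoly.IsHomogeneous 2 :=
  IsHomogeneous.sum _ _ _ fun i _ => (isHomogeneous_X ℂ i).mul (isHomogeneous_X ℂ i)

lemma isHomogeneous_zonalPoly (a : Fin 3 → ℂ) (k : ℕ) : (zonalPoly a k).IsHomogeneous k := by
  induction k using Nat.twoStepInduction with
  | zero => exact isHomogeneous_one _ _
  | one => exact isHomogeneous_linForm a
  | more n h0 h1 =>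
    rw [zonalPoly]
    refine IsHomogeneous.sub ?_ ?_
    · have := (isHomogeneous_C (Fin 3) ((2 * n + 3) / (n + 2) : ℂ)).mul
        ((isHomogeneous_linForm a).mul h1)
      rwa [show 0 + (1 + (n + 1)) = n + 2 by ring] at this
    · have := (isHomogeneous_C (Fin 3) ((n + 1) / (n + 2) : ℂ)).mul
        (isHomogeneous_normSqPoly.mul h0)
      rwa [show 0 + (2 + n) = n + 2 by ring] at this

lemma dirDeriv_mul (a : Fin 3 → ℂ) (P Q : MvPolynomial (Fin 3) ℂ) :
    dirDeriv a (P * Q) = dirDeriv a P * Q + P * dirDeriv a Q := by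
  simp only [dirDeriv, Fin.sum_univ_three, pderiv_mul]; ring

lemma dirDeriv_sub (a : Fin 3 → ℂ) (P Q : MvPolynomial (Fin 3) ℂ) :
    dirDeriv a (P - Q) = dirDeriv a P - dirDeriv a Q := by
  simp only [dirDeriv, Fin.sum_univ_three, map_sub]; ring

lemma dirDeriv_C_mul (a : Fin 3 → ℂ) (c : ℂ) (P : MvPolynomial (Fin 3) ℂ) :
    dirDeriv a (C c * P) = C c * dirDeriv a P := by
  simp only [dirDeriv, Fin.sum_univ_three, pderiv_C_mul]; ring

lemma dirDeriv_linForm {a : Fin 3 → ℂ} (ha : ∑ i, a i ^ 2 = 1) : dirDeriv a (linForm a) = 1 := by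
  have h := congrArg (C (σ := Fin 3)) ha
  simp only [Fin.sum_univ_three, C_add, C_pow, C_1] at h
  simp only [dirDeriv, linForm, Fin.sum_univ_three, map_add, pderiv_C_mul, pderiv_X]
  simp
  linear_combination h

lemma dirDeriv_normSqPoly (a : Fin 3 → ℂ) : dirDeriv a normSqPoly = 2 * linForm a := by
  simp only [dirDeriv, linForm, normSqPoly, Fin.sum_univ_three, map_add, pderiv_mul, pderiv_X]
  simp
  ring

lemma dirDeriv_zonalPoly {a : Fin 3 → ℂ} (ha : ∑ i, a i ^ 2 = 1) (k : ℕ) :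
    dirDeriv a (zonalPoly a k) = C (k : ℂ) * zonalPoly a (k - 1) := by
  induction k using Nat.twoStepInduction with
  | zero => simp [zonalPoly, dirDeriv]
  | one => simp [zonalPoly, dirDeriv_linForm ha]
  | more n h0 h1 =>
    have hn : (n : ℂ) + 2 ≠ 0 := by exact_mod_cast Nat.succ_ne_zero (n + 1)
    have hrec := linForm_mul_zonalPoly a n
    have e1 : ((n + 2 : ℕ) : ℂ) * ((2 * n + 3) / (n + 2)) = 2 * n + 3 := by push_cast; field_simp
    have e2 : ((n + 2 : ℕ) : ℂ) * ((n + 1) / (n + 2)) = n + 1 := by push_cast; field_simp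
    have key : C ((n + 2 : ℕ) : ℂ) * dirDeriv a (zonalPoly a (n + 2)) =
        C ((n + 2 : ℕ) : ℂ) * (C ((n + 2 : ℕ) : ℂ) * zonalPoly a (n + 1)) := by
      rw [← dirDeriv_C_mul, zonalPoly, mul_sub, ← mul_assoc (C _) (C _), ← mul_assoc (C _) (C _),
        ← C_mul, ← C_mul, e1, e2, dirDeriv_sub, dirDeriv_C_mul, dirDeriv_C_mul, dirDeriv_mul,
        dirDeriv_mul, dirDeriv_linForm ha, dirDeriv_normSqPoly, h0, h1]
      simp only [Nat.add_sub_cancel]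
      push_cast
      simp only [C_add, C_mul, C_1, map_natCast, map_ofNat] at hrec ⊢
      linear_combination (n + 1 : MvPolynomial (Fin 3) ℂ) * hrec
    exact mul_left_cancel₀ (by rw [Ne, C_eq_zero]; exact_mod_cast Nat.succ_ne_zero (n + 1)) key

lemma polyLaplacian_linForm_mul (a : Fin 3 → ℂ) (P : MvPolynomial (Fin 3) ℂ) :
    polyLaplacian (linForm a * P) = linForm a * polyLaplacian P + 2 * dirDeriv a P := by
  simp only [polyLaplacian_apply, linForm, dirDeriv, Fin.sum_univ_three, pderiv_mul, map_add,
    pderiv_X, pderiv_C]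
  simp
  ring

lemma polyLaplacian_normSqPoly_mul {k : ℕ} {P : MvPolynomial (Fin 3) ℂ} (hP : P.IsHomogeneous k) :
    polyLaplacian (normSqPoly * P) = normSqPoly * polyLaplacian P + C (4 * k + 6 : ℂ) * P := by
  have h := hP.sum_X_mul_pderiv
  simp only [Fin.sum_univ_three, nsmul_eq_mul] at h
  simp only [polyLaplacian_apply, normSqPoly, Fin.sum_univ_three, pderiv_mul, map_add,
    pderiv_X]
  simp only [C_mul, map_natCast, map_ofNat]
  simp
  linear_combination 4 * h

lemma zonalPoly_mem_harmonicSubmodule {a : Fin 3 → ℂ} (ha : ∑ i, a i ^ 2 = 1) (k : ℕ) :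
    zonalPoly a k ∈ harmonicSubmodule k := by
  refine mem_harmonicSubmodule.2 ⟨isHomogeneous_zonalPoly a k, ?_⟩
  induction k using Nat.twoStepInduction with
  | zero => simp [zonalPoly, polyLaplacian_apply]
  | one =>
    have := polyLaplacian_linForm_mul a 1
    simpa [zonalPoly, polyLaplacian_apply, dirDeriv] using this
  | more n h0 h1 =>
    rw [zonalPoly, ← smul_eq_C_mul, ← smul_eq_C_mul, map_sub, map_smul, map_smul,
      polyLaplacian_linForm_mul, polyLaplacian_normSqPoly_mul (isHomogeneous_zonalPoly a n),
      h0, h1, dirDeriv_zonalPoly ha, smul_eq_C_mul, smul_eq_C_mul]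
    have hn : (n : ℂ) + 2 ≠ 0 := by exact_mod_cast Nat.succ_ne_zero (n + 1)
    have e : C (((2 * n + 3) / (n + 2)) * (2 * (n + 1)) : ℂ) =
        (C (((n + 1) / (n + 2)) * (4 * n + 6) : ℂ) : MvPolynomial (Fin 3) ℂ) := by
      congr 1; field_simp; ring
    simp only [Nat.add_sub_cancel]
    push_cast
    simp only [C_mul, C_add, C_1, map_natCast, map_ofNat] at e ⊢
    linear_combination zonalPoly a n * e

lemma sphereIntegral_normSqPoly_mul (P : MvPolynomial (Fin 3) ℂ) :
    sphereIntegral (normSqPoly * P) = sphereIntegral P := by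
  rw [sphereIntegral_apply, sphereIntegral_apply]
  congr 1; ext x
  have hx : ∑ i, (x : E3) i ^ 2 = 1 := by
    rw [← EuclideanSpace.real_norm_sq_eq, norm_eq_of_mem_sphere]; norm_num
  have : ∑ i, (((x : E3) i : ℝ) : ℂ) ^ 2 = 1 := by exact_mod_cast hx
  rw [map_mul, ContinuousMap.mul_apply, sphereRestrict_apply normSqPoly]
  simp [normSqPoly, ← sq, this]

/-- Reproducing property of the zonal harmonics. -/
lemma sphereIntegral_zonalPoly_mul {a : Fin 3 → ℂ} (ha : ∑ i, a i ^ 2 = 1) {k : ℕ}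
    {P : MvPolynomial (Fin 3) ℂ} (hP : P ∈ harmonicSubmodule k) :
    (2 * k + 1) * sphereIntegral (zonalPoly a k * P) = sphereIntegral 1 * eval a P := by
  induction k generalizing P with
  | zero =>
    have h := (mem_harmonicSubmodule.1 hP).1
    rw [← totalDegree_zero_iff_isHomogeneous, totalDegree_eq_zero_iff_eq_C] at h
    rw [h]
    have : zonalPoly a 0 * C (coeff 0 P) = coeff 0 P • 1 := by simp [zonalPoly, smul_eq_C_mul]
    rw [this, map_smul]
    simp [mul_comm]
  | succ k ih =>
    obtain ⟨hPh, hPl⟩ := mem_harmonicSubmodule.1 hP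
    have hzk := zonalPoly_mem_harmonicSubmodule ha
    have hD : dirDeriv a P ∈ harmonicSubmodule k := by
      refine mem_harmonicSubmodule.2 ⟨IsHomogeneous.sum _ _ _ fun i _ => ?_, ?_⟩
      · simpa using (isHomogeneous_C (Fin 3) (a i)).mul (hPh.pderiv (i := i))
      · have : polyLaplacian (dirDeriv a P) = dirDeriv a (polyLaplacian P) := by
          simp only [polyLaplacian_apply, dirDeriv, map_sum, pderiv_C_mul, Finset.mul_sum]
          refine Finset.sum_congr rfl fun i _ => Finset.sum_congr rfl fun j _ => ?_
          rw [pderiv_comm j i P, pderiv_comm j i (pderiv j P)]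
        rw [this, hPl]; simp [dirDeriv]
    have hev : eval a (dirDeriv a P) = (k + 1) * eval a P := by
      have := congrArg (eval a) hPh.sum_X_mul_pderiv
      simpa [dirDeriv] using this
    have hibp : sphereIntegral (dirDeriv a (zonalPoly a k * P)) =
        (2 * k + 3) * sphereIntegral (linForm a * zonalPoly a k * P) := by
      have e : linForm a * zonalPoly a k * P = ∑ i, a i • (X i * (zonalPoly a k * P)) := by
        simp only [linForm, Finset.sum_mul, smul_eq_C_mul]; congr 1; ext1 i; ring
      rw [e, dirDeriv, map_sum, map_sum, Finset.mul_sum]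
      refine Finset.sum_congr rfl fun i _ => ?_
      rw [← smul_eq_C_mul, map_smul, map_smul,
        sphereIntegral_pderiv ((isHomogeneous_zonalPoly a k).mul hPh)]
      push_cast; simp only [smul_eq_mul]; ring
    have hzero : ∀ n, n ≠ k + 1 → sphereIntegral (zonalPoly a n * P) = 0 := fun n hn =>
      sphereIntegral_mul_eq_zero (hzk n) hP hn
    have h1 : sphereIntegral (dirDeriv a (zonalPoly a k * P)) =
        sphereIntegral (zonalPoly a k * dirDeriv a P) := by
      rw [dirDeriv_mul, dirDeriv_zonalPoly ha, map_add, mul_assoc, ← smul_eq_C_mul, map_smul,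
        hzero (k - 1) (by omega), smul_zero, zero_add]
    have h2 : (2 * k + 1) * sphereIntegral (linForm a * zonalPoly a k * P) =
        (k + 1) * sphereIntegral (zonalPoly a (k + 1) * P) := by
      have h := congrArg (fun F => sphereIntegral (F * P)) (linForm_mul_zonalPoly a k)
      rw [add_mul, mul_assoc (C _), mul_assoc (C _), mul_assoc (C _), map_add sphereIntegral,
        mul_assoc normSqPoly, ← smul_eq_C_mul, ← smul_eq_C_mul, ← smul_eq_C_mul,
        map_smul, map_smul, map_smul, sphereIntegral_normSqPoly_mul, hzero (k - 1) (by omega),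
        smul_zero, add_zero] at h
      exact h
    have h3 := ih hD
    rw [← h1, hibp, hev] at h3
    have hk : (k : ℂ) + 1 ≠ 0 := by exact_mod_cast Nat.succ_ne_zero k
    refine mul_left_cancel₀ hk ?_
    push_cast
    linear_combination h3 - (2 * k + 3) * h2

/-- Integration of continuous functions over the sphere. -/
noncomputable def integralSphere : C(S2, ℂ) →ₗ[ℂ] ℂ where
  toFun f := ∫ x, f x ∂sphereMeasure
  map_add' f g := integral_add f.integrable_sphere g.integrable_sphere
  map_smul' c _ := integral_const_mul c _

lemma integralSphere_apply (f : C(S2, ℂ)) : integralSphere f = ∫ x, f x ∂sphereMeasure := rfl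

lemma integralSphere_star (f : C(S2, ℂ)) :
    integralSphere (star f) = star (integralSphere f) :=
  integral_conj

/-- The total area of the sphere. -/
noncomputable def sphereArea : ℝ := sphereMeasure.real Set.univ

lemma sphereArea_pos : 0 < sphereArea := by
  rw [sphereArea, sphereMeasure, Measure.toSphere_real_apply_univ, finrank_euclideanSpace_fin]
  have : 0 < volume.real (ball (0 : E3) 1) :=
    ENNReal.toReal_pos (measure_ball_pos _ _ one_pos).ne' measure_ball_lt_top.ne
  positivity

lemma integralSphere_one : integralSphere 1 = sphereArea := by
  simp [integralSphere_apply, sphereArea]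

/-- Spherical harmonics of degree `k`, as a space of continuous functions. -/
noncomputable def sphericalHarmonic (k : ℕ) : Submodule ℂ C(S2, ℂ) :=
  (harmonicSubmodule k).map sphereRestrict.toLinearMap

lemma mem_sphericalHarmonic {k : ℕ} {f : C(S2, ℂ)} :
    f ∈ sphericalHarmonic k ↔ ∃ P ∈ harmonicSubmodule k, sphereRestrict P = f := Iff.rfl

instance (k : ℕ) : FiniteDimensional ℂ (sphericalHarmonic k) := by
  have : FiniteDimensional ℂ (homogeneousSubmodule (Fin 3) ℂ k) :=
    Module.Finite.iff_fg.2 (homogeneousSubmodule_fg _ _ k)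
  have : FiniteDimensional ℂ (harmonicSubmodule k) :=
    Submodule.finiteDimensional_of_le inf_le_left
  unfold sphericalHarmonic
  infer_instance

lemma integralSphere_mul_eq_zero {j k : ℕ} {f g : C(S2, ℂ)} (hf : f ∈ sphericalHarmonic j)
    (hg : g ∈ sphericalHarmonic k) (hjk : j ≠ k) : integralSphere (f * g) = 0 := by
  obtain ⟨P, hP, rfl⟩ := mem_sphericalHarmonic.1 hf
  obtain ⟨Q, hQ, rfl⟩ := mem_sphericalHarmonic.1 hg
  rw [← map_mul]
  exact sphereIntegral_mul_eq_zero hP hQ hjk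

lemma sphereRestrict_map_star (P : MvPolynomial (Fin 3) ℂ) :
    sphereRestrict (map (starRingEnd ℂ) P) = star (sphereRestrict P) := by
  induction P using MvPolynomial.induction_on with
  | C a =>
    ext x
    rw [map_C, ContinuousMap.star_apply, sphereRestrict_apply, sphereRestrict_apply]
    simp
  | add p q hp hq => simp [hp, hq]
  | mul_X p i hp =>
    rw [map_mul, map_mul, map_mul, hp, star_mul']
    congr 1
    ext x
    rw [map_X, ContinuousMap.star_apply, sphereRestrict_apply]
    simp

lemma star_mem_sphericalHarmonic {k : ℕ} {f : C(S2, ℂ)} (hf : f ∈ sphericalHarmonic k) :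
    star f ∈ sphericalHarmonic k := by
  obtain ⟨P, hP, rfl⟩ := mem_sphericalHarmonic.1 hf
  obtain ⟨hPh, hPl⟩ := mem_harmonicSubmodule.1 hP
  refine mem_sphericalHarmonic.2 ⟨_, mem_harmonicSubmodule.2 ⟨hPh.map _, ?_⟩,
    sphereRestrict_map_star P⟩
  rw [polyLaplacian_apply] at hPl ⊢
  simp only [pderiv_map, ← map_sum, hPl, map_zero]

lemma sum_sq_coord_sphere (x : S2) : ∑ i, (((x : E3) i : ℝ) : ℂ) ^ 2 = 1 := by
  have hx : ∑ i, (x : E3) i ^ 2 = 1 := by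
    rw [← EuclideanSpace.real_norm_sq_eq, norm_eq_of_mem_sphere]; norm_num
  exact_mod_cast hx

/-- The zonal harmonic of degree `k` with pole `x`: the reproducing kernel of
`sphericalHarmonic k`. -/
noncomputable def zonalHarmonic (k : ℕ) (x : S2) : C(S2, ℂ) :=
  (((2 * k + 1) / sphereArea : ℝ) : ℂ) •
    sphereRestrict (zonalPoly (fun i => (((x : E3) i : ℝ) : ℂ)) k)

lemma zonalHarmonic_mem (k : ℕ) (x : S2) : zonalHarmonic k x ∈ sphericalHarmonic k :=
  Submodule.smul_mem _ _ (mem_sphericalHarmonic.2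
    ⟨_, zonalPoly_mem_harmonicSubmodule (sum_sq_coord_sphere x) k, rfl⟩)

lemma integralSphere_zonalHarmonic_mul {k : ℕ} {f : C(S2, ℂ)} (hf : f ∈ sphericalHarmonic k)
    (x : S2) : integralSphere (zonalHarmonic k x * f) = f x := by
  obtain ⟨P, hP, rfl⟩ := mem_sphericalHarmonic.1 hf
  have h := sphereIntegral_zonalPoly_mul (sum_sq_coord_sphere x) hP
  have h1 : sphereIntegral 1 = sphereArea := by
    rw [← integralSphere_one, sphereIntegral_apply, map_one]; rfl
  have h2 : (sphereArea : ℂ) ≠ 0 := by exact_mod_cast sphereArea_pos.ne'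
  have h3 : integralSphere (sphereRestrict (zonalPoly (fun i => (((x : E3) i : ℝ) : ℂ)) k) *
      sphereRestrict P) =
      sphereIntegral (zonalPoly (fun i => (((x : E3) i : ℝ) : ℂ)) k * P) := by
    rw [← map_mul]; rfl
  rw [zonalHarmonic, smul_mul_assoc, map_smul, h3, sphereRestrict_apply, smul_eq_mul]
  rw [h1] at h
  push_cast
  field_simp
  exact h

lemma sphereRestrict_zonalPoly (k : ℕ) (x y : S2) :
    sphereRestrict (zonalPoly (fun i => (((x : E3) i : ℝ) : ℂ)) k) y =
      legendreP k (∑ i, (x : E3) i * (y : E3) i) := by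
  have hn : eval (fun i => (((y : E3) i : ℝ) : ℂ)) normSqPoly = 1 := by
    have := sum_sq_coord_sphere y
    simpa [normSqPoly, ← sq] using this
  have hl : eval (fun i => (((y : E3) i : ℝ) : ℂ)) (linForm fun i => (((x : E3) i : ℝ) : ℂ)) =
      ((∑ i, (x : E3) i * (y : E3) i : ℝ) : ℂ) := by
    simp [linForm]
  rw [sphereRestrict_apply]
  induction k using Nat.twoStepInduction with
  | zero => simp [zonalPoly, legendreP]
  | one => rw [zonalPoly, legendreP, hl]
  | more n h0 h1 =>
    rw [zonalPoly, legendreP, map_sub, map_mul, map_mul, map_mul, map_mul, eval_C, eval_C, hl, hn,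
      h0, h1]
    push_cast
    ring

lemma zonalHarmonic_apply (k : ℕ) (x y : S2) :
    zonalHarmonic k x y =
      (((2 * k + 1) / sphereArea * legendreP k (∑ i, (x : E3) i * (y : E3) i) : ℝ) : ℂ) := by
  rw [zonalHarmonic, ContinuousMap.smul_apply, sphereRestrict_zonalPoly, smul_eq_mul]
  push_cast
  rfl

lemma star_zonalHarmonic (k : ℕ) (x : S2) : star (zonalHarmonic k x) = zonalHarmonic k x := by
  ext y
  rw [ContinuousMap.star_apply, zonalHarmonic_apply]
  exact Complex.conj_ofReal _

/-- The coefficients of the expansion of a product of zonal harmonics. -/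
noncomputable def zonalCoeff (k l j : ℕ) : ℝ :=
  (2 * k + 1) * (2 * l + 1) * legendreTriple k l j / sphereArea

lemma zonalCoeff_nonneg (k l j : ℕ) : 0 ≤ zonalCoeff k l j := by
  have := legendreTriple_nonneg k l j
  have := sphereArea_pos
  unfold zonalCoeff
  positivity

lemma zonalHarmonic_mul (k l : ℕ) {N : ℕ} (hN : k + l < N) (x : S2) :
    zonalHarmonic k x * zonalHarmonic l x =
      ∑ j ∈ Finset.range N, (zonalCoeff k l j : ℂ) • zonalHarmonic j x := by
  ext y
  rw [ContinuousMap.mul_apply, ContinuousMap.sum_apply]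
  simp only [ContinuousMap.smul_apply, zonalHarmonic_apply, smul_eq_mul]
  norm_cast
  have h := legendreP_mul (∑ i, (x : E3) i * (y : E3) i) k l hN
  calc _ = (2 * k + 1) / sphereArea * ((2 * l + 1) / sphereArea) *
        (legendreP k (∑ i, (x : E3) i * (y : E3) i) *
          legendreP l (∑ i, (x : E3) i * (y : E3) i)) := by push_cast; ring
    _ = _ := by
      rw [h, Finset.mul_sum]
      refine Finset.sum_congr rfl fun j _ => ?_
      simp only [zonalCoeff]
      push_cast
      ring

/-- The inclusion of continuous functions on the sphere in `L²`. -/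
noncomputable def sphereToLp : C(S2, ℂ) →L[ℂ] Lp ℂ 2 sphereMeasure :=
  ContinuousMap.toLp 2 sphereMeasure ℂ

lemma inner_sphereToLp (f g : C(S2, ℂ)) :
    inner ℂ (sphereToLp f) (sphereToLp g) = integralSphere (star f * g) := by
  rw [sphereToLp, ContinuousMap.inner_toLp, integralSphere_apply]
  congr 1
  ext x
  exact mul_comm _ _

lemma sphericalHarmonic_apply_eq_inner {k : ℕ} {f : C(S2, ℂ)} (hf : f ∈ sphericalHarmonic k)
    (x : S2) : f x = inner ℂ (sphereToLp (zonalHarmonic k x)) (sphereToLp f) := by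
  rw [inner_sphereToLp, star_zonalHarmonic, integralSphere_zonalHarmonic_mul hf]

lemma exists_basis_sphericalHarmonic (k : ℕ) :
    ∃ (d : ℕ) (e : Fin d → C(S2, ℂ)), (∀ m, e m ∈ sphericalHarmonic k) ∧
      ∀ f ∈ sphericalHarmonic k, f = ∑ m, integralSphere (star (e m) * f) • e m := by
  set V := (sphericalHarmonic k).map (sphereToLp : C(S2, ℂ) →ₗ[ℂ] Lp ℂ 2 sphereMeasure) with hV
  let b := stdOrthonormalBasis ℂ V
  have hb : ∀ m, ∃ f ∈ sphericalHarmonic k, sphereToLp f = b m := fun m => (b m).2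
  choose e he hbe using hb
  refine ⟨_, e, he, fun f hf => ?_⟩
  have h1 : sphereToLp f = sphereToLp (∑ m, integralSphere (star (e m) * f) • e m) := by
    have := congrArg Subtype.val (b.sum_repr' ⟨sphereToLp f, f, hf, rfl⟩)
    refine this.symm.trans ?_
    rw [map_sum]
    simp only [map_smul, ← inner_sphereToLp, hbe]
    simp
  ext x
  rw [sphericalHarmonic_apply_eq_inner hf, h1, ← sphericalHarmonic_apply_eq_inner
    (Submodule.sum_mem _ fun m _ => Submodule.smul_mem _ _ (he m))]

/-- The dimension of the space of spherical harmonics of degree `k`. -/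
noncomputable def harmonicDim (k : ℕ) : ℕ := (exists_basis_sphericalHarmonic k).choose

/-- An orthonormal basis of the space of spherical harmonics of degree `k`; the property used
is `sum_harmonicBasis`. -/
noncomputable def harmonicBasis (k : ℕ) : Fin (harmonicDim k) → C(S2, ℂ) :=
  (exists_basis_sphericalHarmonic k).choose_spec.choose

lemma harmonicBasis_mem (k : ℕ) (m : Fin (harmonicDim k)) :
    harmonicBasis k m ∈ sphericalHarmonic k :=
  (exists_basis_sphericalHarmonic k).choose_spec.choose_spec.1 m

lemma sum_harmonicBasis {k : ℕ} {f : C(S2, ℂ)} (hf : f ∈ sphericalHarmonic k) :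
    ∑ m, integralSphere (star (harmonicBasis k m) * f) • harmonicBasis k m = f :=
  ((exists_basis_sphericalHarmonic k).choose_spec.choose_spec.2 f hf).symm

lemma sum_star_harmonicBasis_smul (k : ℕ) (x : S2) :
    ∑ m, star (harmonicBasis k m x) • harmonicBasis k m = zonalHarmonic k x := by
  rw [← sum_harmonicBasis (zonalHarmonic_mem k x)]
  refine Finset.sum_congr rfl fun m _ => ?_
  congr 1
  rw [← integralSphere_zonalHarmonic_mul (harmonicBasis_mem k m) x, ← integralSphere_star,
    star_mul', star_zonalHarmonic, mul_comm]

/-- The squared `L²` norm. -/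
noncomputable def sphereNormSq (f : C(S2, ℂ)) : ℝ := ‖sphereToLp f‖ ^ 2

lemma sphereNormSq_nonneg (f : C(S2, ℂ)) : 0 ≤ sphereNormSq f := sq_nonneg _

lemma integralSphere_star_mul_self (f : C(S2, ℂ)) :
    integralSphere (star f * f) = sphereNormSq f := by
  rw [← inner_sphereToLp, inner_self_eq_norm_sq_to_K, sphereNormSq]
  norm_cast

lemma sphereNormSq_star (f : C(S2, ℂ)) : sphereNormSq (star f) = sphereNormSq f := by
  have h1 := integralSphere_star_mul_self f
  have h2 := integralSphere_star_mul_self (star f)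
  rw [star_star, mul_comm, h1] at h2
  exact_mod_cast h2.symm

/-- The squared `L²` norm of the orthogonal projection on spherical harmonics of degree `j`. -/
noncomputable def harmonicEnergy (j : ℕ) (φ : C(S2, ℂ)) : ℝ :=
  ∑ m, ‖integralSphere (star (harmonicBasis j m) * φ)‖ ^ 2

lemma harmonicEnergy_nonneg (j : ℕ) (φ : C(S2, ℂ)) : 0 ≤ harmonicEnergy j φ :=
  Finset.sum_nonneg fun _ _ => sq_nonneg _

/-- The orthogonal projection on spherical harmonics of degree `j`. -/
noncomputable def harmonicProj (j : ℕ) (φ : C(S2, ℂ)) : C(S2, ℂ) :=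
  ∑ m, integralSphere (star (harmonicBasis j m) * φ) • harmonicBasis j m

lemma harmonicProj_mem (j : ℕ) (φ : C(S2, ℂ)) : harmonicProj j φ ∈ sphericalHarmonic j :=
  Submodule.sum_mem _ fun m _ => Submodule.smul_mem _ _ (harmonicBasis_mem j m)

lemma integralSphere_star_harmonicProj_mul (j : ℕ) (φ : C(S2, ℂ)) :
    integralSphere (star (harmonicProj j φ) * φ) = harmonicEnergy j φ := by
  rw [harmonicProj, star_sum, Finset.sum_mul, map_sum, harmonicEnergy]
  push_cast
  refine Finset.sum_congr rfl fun m _ => ?_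
  rw [star_smul, smul_mul_assoc, map_smul, smul_eq_mul]
  exact Complex.conj_mul' _

lemma integralSphere_star_mul_harmonicProj {j : ℕ} {f : C(S2, ℂ)} (hf : f ∈ sphericalHarmonic j)
    (φ : C(S2, ℂ)) :
    integralSphere (star f * harmonicProj j φ) = integralSphere (star f * φ) := by
  conv_rhs => rw [← sum_harmonicBasis hf]
  rw [harmonicProj, star_sum, Finset.sum_mul, map_sum, Finset.mul_sum, map_sum]
  refine Finset.sum_congr rfl fun m _ => ?_
  rw [mul_smul_comm, map_smul, star_smul, smul_mul_assoc, map_smul, smul_eq_mul, smul_eq_mul,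
    ← integralSphere_star, star_mul', star_star, mul_comm, mul_comm (star f)]

lemma integralSphere_star_mul_harmonicProj_of_ne {i j : ℕ} (hij : i ≠ j) {f : C(S2, ℂ)}
    (hf : f ∈ sphericalHarmonic i) (φ : C(S2, ℂ)) :
    integralSphere (star f * harmonicProj j φ) = 0 :=
  integralSphere_mul_eq_zero (star_mem_sphericalHarmonic hf) (harmonicProj_mem j φ) hij

/-- The part of `φ` orthogonal to the spherical harmonics with degree in `s`. -/
noncomputable def harmonicRemainder (s : Finset ℕ) (φ : C(S2, ℂ)) : C(S2, ℂ) :=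
  φ - ∑ j ∈ s, harmonicProj j φ

lemma integralSphere_star_mul_harmonicRemainder {i : ℕ} {f : C(S2, ℂ)}
    (hf : f ∈ sphericalHarmonic i) (s : Finset ℕ) (φ : C(S2, ℂ)) :
    integralSphere (star f * harmonicRemainder s φ) =
      if i ∈ s then 0 else integralSphere (star f * φ) := by
  rw [harmonicRemainder, mul_sub, map_sub, Finset.mul_sum, map_sum]
  split_ifs with h
  · rw [Finset.sum_eq_single_of_mem i h fun j _ hj =>
      integralSphere_star_mul_harmonicProj_of_ne hj.symm hf φ,
      integralSphere_star_mul_harmonicProj hf, sub_self]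
  · rw [Finset.sum_eq_zero fun j hj => integralSphere_star_mul_harmonicProj_of_ne
      (by rintro rfl; exact h hj) hf φ, sub_zero]

lemma harmonicEnergy_harmonicRemainder_of_mem {s : Finset ℕ} {j : ℕ} (hj : j ∈ s)
    (φ : C(S2, ℂ)) : harmonicEnergy j (harmonicRemainder s φ) = 0 := by
  simp [harmonicEnergy, integralSphere_star_mul_harmonicRemainder (harmonicBasis_mem j _), hj]

lemma integralSphere_star_harmonicRemainder_mul (s : Finset ℕ) (φ : C(S2, ℂ)) :
    integralSphere (star (harmonicRemainder s φ) * φ) = sphereNormSq (harmonicRemainder s φ) := by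
  have h : ∑ j ∈ s, integralSphere (star (harmonicProj j φ) * harmonicRemainder s φ) = 0 :=
    Finset.sum_eq_zero fun j hj => by
      rw [integralSphere_star_mul_harmonicRemainder (harmonicProj_mem j φ), if_pos hj]
  have h' : integralSphere (star (harmonicRemainder s φ) * ∑ j ∈ s, harmonicProj j φ) = 0 := by
    rw [← map_sum, ← Finset.sum_mul, ← star_sum] at h
    rw [← star_inj, ← integralSphere_star, star_mul', star_star, mul_comm, h, star_zero]
  rw [← integralSphere_star_mul_self]
  have h2 : star (harmonicRemainder s φ) * harmonicRemainder s φ =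
      star (harmonicRemainder s φ) * φ -
        star (harmonicRemainder s φ) * ∑ j ∈ s, harmonicProj j φ := by
    rw [← mul_sub]; rfl
  rw [h2, map_sub, h', sub_zero]

lemma sphereNormSq_eq_add (s : Finset ℕ) (φ : C(S2, ℂ)) :
    sphereNormSq φ = sphereNormSq (harmonicRemainder s φ) + ∑ j ∈ s, harmonicEnergy j φ := by
  have h := integralSphere_star_harmonicRemainder_mul s φ
  have h2 : star (harmonicRemainder s φ) * φ =
      star φ * φ - ∑ j ∈ s, star (harmonicProj j φ) * φ := by
    rw [harmonicRemainder, star_sub, sub_mul, star_sum, Finset.sum_mul]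
  rw [h2, map_sub, map_sum, integralSphere_star_mul_self] at h
  simp only [integralSphere_star_harmonicProj_mul] at h
  have h' : sphereNormSq φ - ∑ j ∈ s, harmonicEnergy j φ =
    sphereNormSq (harmonicRemainder s φ) := by exact_mod_cast h
  linarith

lemma sum_harmonicEnergy_le (s : Finset ℕ) (φ : C(S2, ℂ)) :
    ∑ j ∈ s, harmonicEnergy j φ ≤ sphereNormSq φ := by
  rw [sphereNormSq_eq_add s φ]
  linarith [sphereNormSq_nonneg (harmonicRemainder s φ)]

lemma harmonicEnergy_le (j : ℕ) (φ : C(S2, ℂ)) : harmonicEnergy j φ ≤ sphereNormSq φ := by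
  simpa using sum_harmonicEnergy_le {j} φ

lemma harmonicEnergy_eq_zero {j k : ℕ} (hjk : j ≠ k) {f : C(S2, ℂ)}
    (hf : f ∈ sphericalHarmonic k) : harmonicEnergy j f = 0 := by
  refine Finset.sum_eq_zero fun m _ => ?_
  rw [integralSphere_mul_eq_zero (star_mem_sphericalHarmonic (harmonicBasis_mem j m)) hf hjk]
  simp

lemma sphereNormSq_harmonicProj (j : ℕ) (φ : C(S2, ℂ)) :
    sphereNormSq (harmonicProj j φ) = harmonicEnergy j φ := by
  have h := integralSphere_star_mul_harmonicProj (harmonicProj_mem j φ) φ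
  rw [integralSphere_star_mul_self, integralSphere_star_harmonicProj_mul] at h
  exact_mod_cast h

lemma sum_norm_sq_integralSphere_of_kernel {ι κ : Type*} (s : Finset ι) (t : Finset κ)
    (u : ι → C(S2, ℂ)) (v : κ → C(S2, ℂ)) (c : κ → ℝ)
    (h : ∀ x, ∑ i ∈ s, star (u i x) • u i = ∑ i ∈ t, ((c i : ℂ) * star (v i x)) • v i)
    (φ : C(S2, ℂ)) :
    ∑ i ∈ s, ‖integralSphere (u i * φ)‖ ^ 2 = ∑ i ∈ t, c i * ‖integralSphere (v i * φ)‖ ^ 2 := by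
  have h1 : ∑ i ∈ s, integralSphere (u i * φ) • star (u i * φ) =
      ∑ i ∈ t, ((c i : ℂ) * integralSphere (v i * φ)) • star (v i * φ) := by
    ext x
    have := congrArg (fun F => integralSphere (F * φ) * star (φ x)) (h x)
    simp only [Finset.sum_mul, map_sum, smul_mul_assoc, map_smul, smul_eq_mul] at this
    simp only [ContinuousMap.sum_apply, ContinuousMap.smul_apply, ContinuousMap.star_apply,
      ContinuousMap.mul_apply, smul_eq_mul, star_mul']
    convert this using 1
    · exact Finset.sum_congr rfl fun i _ => by ring
    · exact Finset.sum_congr rfl fun i _ => by ring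
  have h2 := congrArg integralSphere h1
  simp only [map_sum, map_smul, smul_eq_mul, integralSphere_star, mul_assoc] at h2
  have h3 : ∀ z : ℂ, z * star z = ((‖z‖ ^ 2 : ℝ) : ℂ) := fun z => by
    rw [Complex.ofReal_pow]; exact Complex.mul_conj' z
  simp only [h3] at h2
  exact_mod_cast h2

lemma sum_norm_sq_integralSphere_harmonicBasis_mul (k l : ℕ) {N : ℕ} (hN : k + l < N)
    (φ : C(S2, ℂ)) :
    ∑ p : Fin (harmonicDim k) × Fin (harmonicDim l),
        ‖integralSphere (harmonicBasis k p.1 * harmonicBasis l p.2 * φ)‖ ^ 2 =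
      ∑ j ∈ Finset.range N, zonalCoeff k l j * harmonicEnergy j φ := by
  have h := sum_norm_sq_integralSphere_of_kernel Finset.univ
    ((Finset.range N).sigma fun j => (Finset.univ : Finset (Fin (harmonicDim j))))
    (fun p : Fin (harmonicDim k) × Fin (harmonicDim l) =>
      harmonicBasis k p.1 * harmonicBasis l p.2)
    (fun q => star (harmonicBasis q.1 q.2)) (fun q => zonalCoeff k l q.1) ?_ φ
  · rw [h, Finset.sum_sigma]
    simp only [harmonicEnergy, Finset.mul_sum]
  · intro x
    have hl : ∑ p : Fin (harmonicDim k) × Fin (harmonicDim l),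
        star ((harmonicBasis k p.1 * harmonicBasis l p.2) x) •
          (harmonicBasis k p.1 * harmonicBasis l p.2) = zonalHarmonic k x * zonalHarmonic l x := by
      rw [← sum_star_harmonicBasis_smul, ← sum_star_harmonicBasis_smul, Finset.sum_mul_sum,
        Fintype.sum_prod_type]
      refine Finset.sum_congr rfl fun m _ => Finset.sum_congr rfl fun n _ => ?_
      rw [smul_mul_smul_comm, ContinuousMap.mul_apply, star_mul']
    rw [hl, zonalHarmonic_mul k l hN, Finset.sum_sigma]
    refine Finset.sum_congr rfl fun j _ => ?_
    rw [← star_zonalHarmonic, ← sum_star_harmonicBasis_smul, star_sum, Finset.smul_sum]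
    refine Finset.sum_congr rfl fun m _ => ?_
    rw [star_smul, ContinuousMap.star_apply, smul_smul]

/-- Estimate of a trilinear integral by the energies of the third factor. -/
lemma norm_integralSphere_mul_mul_sq_le {k l : ℕ} {f g : C(S2, ℂ)} (hf : f ∈ sphericalHarmonic k)
    (hg : g ∈ sphericalHarmonic l) {N : ℕ} (hN : k + l < N) (φ : C(S2, ℂ)) :
    ‖integralSphere (f * g * φ)‖ ^ 2 ≤ sphereNormSq f * sphereNormSq g *
      ∑ j ∈ Finset.range N, zonalCoeff k l j * harmonicEnergy j φ := by
  rw [← sum_norm_sq_integralSphere_harmonicBasis_mul k l hN]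
  set a := fun m => integralSphere (star (harmonicBasis k m) * f) with ha
  set b := fun n => integralSphere (star (harmonicBasis l n) * g) with hb
  have h1 : integralSphere (f * g * φ) = ∑ p : Fin (harmonicDim k) × Fin (harmonicDim l),
      a p.1 * b p.2 * integralSphere (harmonicBasis k p.1 * harmonicBasis l p.2 * φ) := by
    conv_lhs => rw [← sum_harmonicBasis hf, ← sum_harmonicBasis hg]
    rw [Finset.sum_mul_sum, ← Fintype.sum_prod_type', Finset.sum_mul, map_sum]
    refine Finset.sum_congr rfl fun p _ => ?_
    rw [smul_mul_smul_comm, smul_mul_assoc, map_smul, smul_eq_mul]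
  have h2 : ∑ p : Fin (harmonicDim k) × Fin (harmonicDim l), (‖a p.1‖ * ‖b p.2‖) ^ 2 =
      harmonicEnergy k f * harmonicEnergy l g := by
    rw [Fintype.sum_prod_type, harmonicEnergy, harmonicEnergy, Finset.sum_mul_sum]
    simp only [mul_pow, ha, hb]
  calc _ ≤ (∑ p : Fin (harmonicDim k) × Fin (harmonicDim l), ‖a p.1‖ * ‖b p.2‖ *
        ‖integralSphere (harmonicBasis k p.1 * harmonicBasis l p.2 * φ)‖) ^ 2 := by
        rw [h1]
        gcongr
        refine (norm_sum_le _ _).trans_eq ?_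
        simp only [norm_mul]
    _ ≤ (∑ p : Fin (harmonicDim k) × Fin (harmonicDim l), (‖a p.1‖ * ‖b p.2‖) ^ 2) *
        ∑ p : Fin (harmonicDim k) × Fin (harmonicDim l),
          ‖integralSphere (harmonicBasis k p.1 * harmonicBasis l p.2 * φ)‖ ^ 2 :=
        Finset.sum_mul_sq_le_sq_mul_sq _ _ _
    _ ≤ _ := by
        rw [h2]
        gcongr
        · exact Finset.sum_nonneg fun _ _ => sq_nonneg _
        · exact sphereNormSq_nonneg f
        · exact harmonicEnergy_le k f
        · exact harmonicEnergy_le l g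

lemma wallis_sq_le (n : ℕ) : wallis n ^ 2 * (n + 1) ≤ 1 := by
  have h : wallis n ^ 2 * (2 * n + 1) ≤ 1 := by
    induction n with
    | zero => simp [wallis_zero]
    | succ n ih =>
      have e := wallis_succ n
      push_cast at e ⊢
      have e' : (2 * n + 2 : ℝ) ^ 2 * (wallis (n + 1) ^ 2 * (2 * (n + 1) + 1)) =
          (2 * n + 1) * (2 * n + 3) * (wallis n ^ 2 * (2 * n + 1)) := by
        linear_combination (2 * n + 3 : ℝ) * ((2 * n + 2) * wallis (n + 1) +
          (2 * n + 1) * wallis n) * e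
      have h3 : (2 * n + 1 : ℝ) * (2 * n + 3) * (wallis n ^ 2 * (2 * n + 1)) ≤
          (2 * n + 2 : ℝ) ^ 2 * 1 := by
        refine mul_le_mul ?_ ih (by positivity) (by positivity)
        nlinarith
      rw [← e'] at h3
      exact le_of_mul_le_mul_left h3 (by positivity)
  refine le_trans ?_ h
  gcongr
  have : (0 : ℝ) ≤ n := n.cast_nonneg
  linarith

lemma le_wallis_sq (n : ℕ) : 1 ≤ wallis n ^ 2 * (4 * (n + 1)) := by
  have h : 1 ≤ wallis (n + 1) ^ 2 * (4 * (n + 1)) := by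
    induction n with
    | zero =>
      have e := wallis_succ 0
      simp only [wallis_zero] at e
      push_cast at e ⊢
      nlinarith
    | succ n ih =>
      have e := wallis_succ (n + 1)
      push_cast at e ⊢
      have e' : (2 * n + 4 : ℝ) ^ 2 * (n + 1) * (wallis (n + 1 + 1) ^ 2 * (4 * (n + 1 + 1))) =
          (2 * n + 3) ^ 2 * (n + 2) * (wallis (n + 1) ^ 2 * (4 * (n + 1))) := by
        linear_combination 4 * (n + 1 : ℝ) * (n + 2) * ((2 * n + 4) * wallis (n + 1 + 1) +
          (2 * n + 3) * wallis (n + 1)) * e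
      have h3 : (2 * n + 4 : ℝ) ^ 2 * (n + 1) * 1 ≤
          (2 * n + 3) ^ 2 * (n + 2) * (wallis (n + 1) ^ 2 * (4 * (n + 1))) := by
        refine mul_le_mul ?_ ih (by positivity) (by positivity)
        nlinarith
      rw [← e'] at h3
      exact le_of_mul_le_mul_left h3 (by positivity)
  refine h.trans ?_
  gcongr
  · exact wallis_nonneg _
  · have e := wallis_succ n
    push_cast at e
    have h1 := wallis_nonneg n
    have h2 : (0 : ℝ) ≤ n := n.cast_nonneg
    nlinarith

lemma legendreTriple_sq_le (a b c : ℕ) :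
    legendreTriple (b + c : ℕ) (a + c : ℕ) (a + b : ℕ) ^ 2 *
      ((a + b + c + 1) * (a + 1) * (b + 1) * (c + 1)) ≤ 4 := by
  rw [legendreTriple_eq (g := (a + b + c : ℕ)) (by push_cast; ring)]
  rw [show ((a + b + c : ℕ) : ℤ) - (b + c : ℕ) = (a : ℕ) by push_cast; ring,
    show ((a + b + c : ℕ) : ℤ) - (a + c : ℕ) = (b : ℕ) by push_cast; ring,
    show ((a + b + c : ℕ) : ℤ) - (a + b : ℕ) = (c : ℕ) by push_cast; ring]
  have ha := wallis_sq_le a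
  have hb := wallis_sq_le b
  have hc := wallis_sq_le c
  have hg := le_wallis_sq (a + b + c)
  have hg0 := wallis_pos (Int.natCast_nonneg (a + b + c))
  generalize hG : wallis ((a + b + c : ℕ) : ℤ) = w at *
  have hG' : (((a + b + c : ℕ) : ℤ) : ℝ) = ((a + b + c : ℕ) : ℝ) := Int.cast_natCast _
  rw [hG', show (a : ℝ) + b + c = ((a + b + c : ℕ) : ℝ) by push_cast; ring]
  generalize ((a + b + c : ℕ)) = g at *
  rw [div_pow, div_mul_eq_mul_div, div_le_iff₀ (by positivity)]
  calc _ = (wallis a ^ 2 * (a + 1)) * (wallis b ^ 2 * (b + 1)) * (wallis c ^ 2 * (c + 1)) *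
        (g + 1) := by ring
    _ ≤ 1 * 1 * 1 * (g + 1) := by gcongr
    _ ≤ (w ^ 2 * (4 * (g + 1))) * (g + 1) := by
      rw [one_mul, one_mul]
      exact mul_le_mul_of_nonneg_right hg (by positivity)
    _ ≤ (w ^ 2 * (4 * (2 * g + 1))) * (2 * g + 1) := by
      have : (g : ℝ) + 1 ≤ 2 * g + 1 := by linarith [g.cast_nonneg (α := ℝ)]
      gcongr
    _ = _ := by ring

lemma legendreTriple_eq_zero_or (k l j : ℕ) :
    legendreTriple k l j = 0 ∨ ∃ a b c : ℕ, k = b + c ∧ l = a + c ∧ j = a + b := by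
  rcases Int.even_or_odd' ((k : ℤ) + l + j) with ⟨g, hg | hg⟩
  · by_cases h : (k : ℤ) ≤ g ∧ (l : ℤ) ≤ g ∧ (j : ℤ) ≤ g
    · exact .inr ⟨(g - k).toNat, (g - l).toNat, (g - j).toNat, by omega, by omega, by omega⟩
    · refine .inl ?_
      rw [legendreTriple_eq hg]
      rcases lt_or_ge g k with h1 | h1
      · rw [wallis_of_neg (n := g - k) (by omega)]; simp
      rcases lt_or_ge g l with h2 | h2
      · rw [wallis_of_neg (n := g - l) (by omega)]; simp
      · rw [wallis_of_neg (n := g - j) (by omega)]; simp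
  · exact .inl (legendreTriple_of_odd ⟨g, hg⟩)

lemma zonalCoeff_le_of_le {M K : ℝ} (hM : 0 ≤ M) {a b c : ℕ}
    (h : 4 * ((2 * (b + c) + 1) * (2 * (a + c) + 1)) ^ 2 ≤
      M ^ 2 * K * ((a + b + c + 1) * (a + 1) * (b + 1) * (c + 1) : ℝ)) :
    zonalCoeff (b + c) (a + c) (a + b) ≤ M * √K / sphereArea := by
  have hs := sphereArea_pos
  rw [zonalCoeff]
  refine div_le_div_of_nonneg_right ?_ hs.le
  have h1 := legendreTriple_sq_le a b c
  set D : ℝ := (a + b + c + 1) * (a + 1) * (b + 1) * (c + 1) with hD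
  have hD0 : 0 < D := by positivity
  set γ := legendreTriple (b + c : ℕ) (a + c : ℕ) (a + b : ℕ)
  have h2 : (((2 * (b + c) + 1) * (2 * (a + c) + 1)) * γ) ^ 2 ≤ M ^ 2 * K := by
    refine le_of_mul_le_mul_right ?_ hD0
    calc _ = ((2 * (b + c) + 1) * (2 * (a + c) + 1) : ℝ) ^ 2 * (γ ^ 2 * D) := by ring
      _ ≤ ((2 * (b + c) + 1) * (2 * (a + c) + 1) : ℝ) ^ 2 * 4 := by gcongr
      _ ≤ _ := by linarith
  push_cast
  refine (Real.le_sqrt_of_sq_le h2).trans_eq ?_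
  rw [Real.sqrt_mul (sq_nonneg M), Real.sqrt_sq hM]

lemma zonalCoeff_le_of_two_mul_le {k l : ℕ} (hkl : 2 * k ≤ l) (j : ℕ) :
    zonalCoeff k l j ≤ 12 * √(1 + k) / sphereArea := by
  have hs := sphereArea_pos
  rcases legendreTriple_eq_zero_or k l j with h | ⟨a, b, c, rfl, rfl, rfl⟩
  · rw [zonalCoeff, h]; simp only [mul_zero, zero_div]; positivity
  · refine zonalCoeff_le_of_le (by norm_num) ?_
    have h1 : (2 * b + c : ℝ) ≤ a := by exact_mod_cast (show 2 * b + c ≤ a by omega)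
    have ha : (0 : ℝ) ≤ a := a.cast_nonneg
    have hb : (0 : ℝ) ≤ b := b.cast_nonneg
    have hc : (0 : ℝ) ≤ c := c.cast_nonneg
    push_cast
    have e1 : (2 * (a + c) + 1 : ℝ) ^ 2 ≤ 8 * ((a + b + c + 1) * (a + 1)) := by nlinarith
    have e2 : (2 * (b + c) + 1 : ℝ) ^ 2 ≤ 4 * (1 + (b + c)) * ((b + 1) * (c + 1)) := by
      have : (0 : ℝ) ≤ b * c := by positivity
      have : (1 + (b + c) : ℝ) * (1 + (b + c)) ≤ (1 + (b + c)) * ((b + 1) * (c + 1)) := by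
        gcongr; linarith
      nlinarith
    calc _ = 4 * ((2 * (b + c) + 1) ^ 2 * (2 * (a + c) + 1) ^ 2 : ℝ) := by ring
      _ ≤ 4 * ((4 * (1 + (b + c)) * ((b + 1) * (c + 1))) *
          (8 * ((a + b + c + 1) * (a + 1)))) := by gcongr
      _ = 128 * ((1 + (b + c)) * ((a + b + c + 1) * (a + 1) * (b + 1) * (c + 1))) := by ring
      _ ≤ 144 * ((1 + (b + c)) * ((a + b + c + 1) * (a + 1) * (b + 1) * (c + 1))) := by
        gcongr; norm_num
      _ = _ := by ring

lemma zonalCoeff_self_le {k j R : ℕ} (hR : k < R * (R + 2)) (hj : ∀ b < R, j ≠ 2 * b) :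
    zonalCoeff k k j ≤ 16 * √(1 + k) / sphereArea := by
  have hs := sphereArea_pos
  rcases legendreTriple_eq_zero_or k k j with h | ⟨a, b, c, h1, h2, rfl⟩
  · rw [zonalCoeff, h]; simp only [mul_zero, zero_div]; positivity
  · obtain rfl : a = b := by omega
    subst h1
    have hb : R ≤ a := by
      by_contra! h
      exact hj a h (by ring)
    have hR' : a + c < a * (a + 2) := hR.trans_le (Nat.mul_le_mul hb (by omega))
    have hR2 : (a + c : ℝ) < a * (a + 2) := by exact_mod_cast hR'
    refine zonalCoeff_le_of_le (by norm_num) ?_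
    have ha : (0 : ℝ) ≤ a := a.cast_nonneg
    have hc : (0 : ℝ) ≤ c := c.cast_nonneg
    push_cast
    have e0 : (2 * (a + c) + 1 : ℝ) ≤ 2 * (1 + (a + c)) := by linarith
    have e1 : (1 + (a + c) : ℝ) ^ 2 ≤ 4 * ((a + 1) ^ 2 * (c + 1)) := by
      rcases le_total (a : ℝ) c with h | h
      · have : (1 + (a + c) : ℝ) * (1 + (a + c)) ≤ (a + 1) ^ 2 * (2 * (c + 1)) := by
          gcongr <;> nlinarith
        nlinarith
      · nlinarith [mul_nonneg (sq_nonneg ((a : ℝ) + 1)) hc, mul_nonneg ha hc]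
    calc _ ≤ 4 * ((2 * (1 + (a + c))) * (2 * (1 + (a + c))) : ℝ) ^ 2 := by gcongr
      _ = 64 * ((1 + (a + c)) * (1 + (a + c)) * (1 + (a + c)) ^ 2) := by ring
      _ ≤ 64 * ((1 + (a + c)) * (a + a + c + 1) * (4 * ((a + 1) ^ 2 * (c + 1)))) := by
        gcongr 64 * (_ * ?_ * ?_)
        linarith
      _ = _ := by ring

lemma zonalCoeff_low_le {k b : ℕ} (hb : 2 * b ≤ k) :
    zonalCoeff (2 * b) k k ≤ 24 / sphereArea := by
  obtain ⟨c, rfl⟩ : ∃ c, k = c + b := ⟨k - b, by omega⟩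
  have h := zonalCoeff_le_of_le (M := 24) (K := 1) (by norm_num) (a := c) (b := b) (c := b) ?_
  · rwa [Real.sqrt_one, mul_one, ← two_mul] at h
  · have h1 : (b : ℝ) ≤ c := by exact_mod_cast (show b ≤ c by omega)
    have hb0 : (0 : ℝ) ≤ b := b.cast_nonneg
    have e1 : (2 * (b + b) + 1 : ℝ) ≤ 4 * (b + 1) := by linarith
    have e2 : (2 * (c + b) + 1 : ℝ) ^ 2 ≤ 8 * ((c + b + b + 1) * (c + 1)) := by nlinarith
    calc _ = 4 * ((2 * (b + b) + 1) ^ 2 * (2 * (c + b) + 1) ^ 2 : ℝ) := by ring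
      _ ≤ 4 * ((4 * (b + 1)) ^ 2 * (8 * ((c + b + b + 1) * (c + 1)))) := by gcongr
      _ = 512 * (((c + b + b + 1) * (c + 1) * (b + 1) * (b + 1))) := by ring
      _ ≤ 576 * (((c + b + b + 1) * (c + 1) * (b + 1) * (b + 1))) := by
        have : (0 : ℝ) ≤ c := c.cast_nonneg
        gcongr; norm_num
      _ = _ := by ring

lemma le_of_sq_le_mul {x y : ℝ} (hy : 0 ≤ y) (h : x ^ 2 ≤ y * x) : x ≤ y := by
  rcases le_or_gt x 0 with hx | hx
  · exact hx.trans hy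
  · exact le_of_mul_le_mul_right (by rwa [← sq]) hx

lemma sphereNormSq_mul_le_of_two_mul_le {k l : ℕ} (hkl : 2 * k ≤ l) {f g : C(S2, ℂ)}
    (hf : f ∈ sphericalHarmonic k) (hg : g ∈ sphericalHarmonic l) :
    sphereNormSq (f * g) ≤
      12 * √(1 + k) / sphereArea * (sphereNormSq f * sphereNormSq g) := by
  have hs := sphereArea_pos
  have hf0 := sphereNormSq_nonneg f
  have hg0 := sphereNormSq_nonneg g
  refine le_of_sq_le_mul (by positivity) ?_
  have h := norm_integralSphere_mul_mul_sq_le hf hg (Nat.lt_succ_self (k + l)) (star (f * g))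
  rw [mul_comm (f * g), integralSphere_star_mul_self, Complex.norm_real, Real.norm_eq_abs,
    sq_abs] at h
  calc _ ≤ _ := h
    _ ≤ sphereNormSq f * sphereNormSq g *
        ∑ j ∈ Finset.range (k + l).succ, 12 * √(1 + k) / sphereArea *
          harmonicEnergy j (star (f * g)) := by
      gcongr with j
      · exact harmonicEnergy_nonneg _ _
      · exact zonalCoeff_le_of_two_mul_le hkl j
    _ ≤ sphereNormSq f * sphereNormSq g * (12 * √(1 + k) / sphereArea *
        sphereNormSq (f * g)) := by
      rw [← Finset.mul_sum, ← sphereNormSq_star (f * g)]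
      gcongr
      exact sum_harmonicEnergy_le _ _
    _ = _ := by ring

lemma harmonicEnergy_mul_star_le {k j : ℕ} {f : C(S2, ℂ)} (hf : f ∈ sphericalHarmonic k) :
    harmonicEnergy j (f * star f) ≤ zonalCoeff j k k * sphereNormSq f ^ 2 := by
  have hz := zonalCoeff_nonneg j k k
  refine le_of_sq_le_mul (by positivity) ?_
  set φ := f * star f with hφ
  have h := norm_integralSphere_mul_mul_sq_le
    (star_mem_sphericalHarmonic (harmonicProj_mem j φ)) hf (Nat.lt_succ_self (j + k)) (star f)
  rw [mul_assoc, ← hφ, integralSphere_star_harmonicProj_mul, Complex.norm_real, Real.norm_eq_abs,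
    sq_abs, sphereNormSq_star, sphereNormSq_harmonicProj,
    Finset.sum_eq_single_of_mem k (Finset.mem_range.2 (by omega)) fun i _ hi => by
      rw [harmonicEnergy_eq_zero hi (star_mem_sphericalHarmonic hf), mul_zero]] at h
  have h1 := harmonicEnergy_le k (star f)
  rw [sphereNormSq_star] at h1
  have h2 := harmonicEnergy_nonneg j φ
  have h3 := sphereNormSq_nonneg f
  calc _ ≤ _ := h
    _ ≤ harmonicEnergy j φ * sphereNormSq f * (zonalCoeff j k k * sphereNormSq f) := by gcongr
    _ = _ := by ring

/-- The `L⁴` bound for spherical harmonics. -/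
lemma sphereNormSq_mul_star_le {k : ℕ} {f : C(S2, ℂ)} (hf : f ∈ sphericalHarmonic k) :
    sphereNormSq (f * star f) ≤ 40 * √(1 + k) / sphereArea * sphereNormSq f ^ 2 := by
  have hs := sphereArea_pos
  have hf0 := sphereNormSq_nonneg f
  set φ := f * star f with hφ
  set R := Nat.sqrt (k + 1) with hR
  have hR1 : R * R ≤ k + 1 := Nat.sqrt_le _
  have hR2 : k + 1 < (R + 1) * (R + 1) := Nat.lt_succ_sqrt _
  set s := (Finset.range R).image fun b => 2 * b with hs'
  set r := harmonicRemainder s φ with hr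
  have hlow : ∑ j ∈ s, harmonicEnergy j φ ≤ 24 * √(1 + k) / sphereArea * sphereNormSq f ^ 2 := by
    have hRs : (R : ℝ) ≤ √(1 + k) := Real.le_sqrt_of_sq_le (by
      have : ((R * R : ℕ) : ℝ) ≤ (k + 1 : ℕ) := by exact_mod_cast hR1
      push_cast at this; nlinarith)
    calc _ ≤ ∑ j ∈ s, 24 / sphereArea * sphereNormSq f ^ 2 := by
          refine Finset.sum_le_sum fun j hj => ?_
          obtain ⟨b, hb, rfl⟩ := Finset.mem_image.1 hj
          have hb' : b + 1 ≤ R := Finset.mem_range.1 hb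
          have : (b + 1) * (b + 1) ≤ k + 1 := (Nat.mul_le_mul hb' hb').trans hR1
          refine (harmonicEnergy_mul_star_le hf).trans ?_
          gcongr
          exact zonalCoeff_low_le (by nlinarith)
      _ = s.card * (24 / sphereArea * sphereNormSq f ^ 2) := by
          rw [Finset.sum_const, nsmul_eq_mul]
      _ ≤ √(1 + k) * (24 / sphereArea * sphereNormSq f ^ 2) := by
          gcongr
          refine le_trans ?_ hRs
          exact_mod_cast Finset.card_image_le.trans_eq (Finset.card_range R)
      _ = _ := by ring
  have hhigh : sphereNormSq r ≤ 16 * √(1 + k) / sphereArea * sphereNormSq f ^ 2 := by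
    refine le_of_sq_le_mul (by positivity) ?_
    have h := norm_integralSphere_mul_mul_sq_le hf (star_mem_sphericalHarmonic hf)
      (Nat.lt_succ_self (k + k)) r
    have e : integralSphere (f * star f * r) = sphereNormSq r := by
      have h1 := congrArg star (integralSphere_star_harmonicRemainder_mul s φ)
      rw [← integralSphere_star, star_mul', star_star, ← hr, mul_comm] at h1
      have h2 : star φ = φ := by rw [hφ, star_mul', star_star, mul_comm]
      rw [h2] at h1
      rw [← hφ, h1]
      exact Complex.conj_ofReal _
    rw [e, Complex.norm_real, Real.norm_eq_abs, sq_abs, sphereNormSq_star] at h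
    calc _ ≤ _ := h
      _ ≤ sphereNormSq f * sphereNormSq f *
          ∑ j ∈ Finset.range (k + k).succ, 16 * √(1 + k) / sphereArea * harmonicEnergy j r := by
        gcongr _ * ?_
        refine Finset.sum_le_sum fun j _ => ?_
        by_cases hj : j ∈ s
        · rw [hr, harmonicEnergy_harmonicRemainder_of_mem hj]; simp
        · refine mul_le_mul_of_nonneg_right (zonalCoeff_self_le (R := R) (by nlinarith) ?_)
            (harmonicEnergy_nonneg _ _)
          rintro b hb rfl
          exact hj (Finset.mem_image.2 ⟨b, Finset.mem_range.2 hb, rfl⟩)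
      _ ≤ sphereNormSq f * sphereNormSq f * (16 * √(1 + k) / sphereArea * sphereNormSq r) := by
        rw [← Finset.mul_sum]
        gcongr
        exact sum_harmonicEnergy_le _ _
      _ = _ := by ring
  rw [sphereNormSq_eq_add s φ, ← hr]
  calc _ ≤ _ := add_le_add hhigh hlow
    _ = _ := by ring

lemma sphereNormSq_mul_sq_le (f g : C(S2, ℂ)) :
    sphereNormSq (f * g) ^ 2 ≤ sphereNormSq (f * star f) * sphereNormSq (g * star g) := by
  have h1 : integralSphere (star (f * star f) * (g * star g)) = sphereNormSq (f * g) := by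
    rw [← integralSphere_star_mul_self, star_mul', star_mul', star_star]
    congr 1
    ring
  have h2 := norm_inner_le_norm (𝕜 := ℂ) (sphereToLp (f * star f)) (sphereToLp (g * star g))
  rw [inner_sphereToLp, h1, Complex.norm_real, Real.norm_eq_abs] at h2
  calc _ = |sphereNormSq (f * g)| ^ 2 := (sq_abs _).symm
    _ ≤ (‖sphereToLp (f * star f)‖ * ‖sphereToLp (g * star g)‖) ^ 2 := by gcongr
    _ = _ := mul_pow _ _ _

lemma sphereNormSq_mul_le {k l : ℕ} {f g : C(S2, ℂ)}
    (hf : f ∈ sphericalHarmonic k) (hg : g ∈ sphericalHarmonic l) :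
    sphereNormSq (f * g) ≤
      80 * √(1 + k) / sphereArea * (sphereNormSq f * sphereNormSq g) := by
  have hs := sphereArea_pos
  have hf0 := sphereNormSq_nonneg f
  have hg0 := sphereNormSq_nonneg g
  rcases le_total (2 * k) l with h | h
  · refine (sphereNormSq_mul_le_of_two_mul_le h hf hg).trans ?_
    gcongr
    norm_num
  · have hl : √(1 + l) ≤ 2 * √(1 + k) := by
      refine Real.sqrt_le_iff.2 ⟨by positivity, ?_⟩
      rw [mul_pow, Real.sq_sqrt (by positivity)]
      have : (l : ℝ) ≤ 2 * k := by exact_mod_cast h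
      linarith
    refine le_of_sq_le_sq ?_ (by positivity)
    calc _ ≤ _ := sphereNormSq_mul_sq_le f g
      _ ≤ (40 * √(1 + k) / sphereArea * sphereNormSq f ^ 2) *
          (40 * √(1 + l) / sphereArea * sphereNormSq g ^ 2) :=
        mul_le_mul (sphereNormSq_mul_star_le hf) (sphereNormSq_mul_star_le hg)
          (sphereNormSq_nonneg _) (by positivity)
      _ ≤ (40 * √(1 + k) / sphereArea * sphereNormSq f ^ 2) *
          (40 * (2 * √(1 + k)) / sphereArea * sphereNormSq g ^ 2) := by gcongr
      _ = 1 / 2 * (80 * √(1 + k) / sphereArea * (sphereNormSq f * sphereNormSq g)) ^ 2 := by ring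
      _ ≤ _ := by
        have := sq_nonneg (80 * √(1 + k) / sphereArea * (sphereNormSq f * sphereNormSq g))
        linarith

lemma IsSphericalHarmonic.exists_continuousMap {k : ℕ} {f : S2 → ℂ}
    (hf : IsSphericalHarmonic k f) : ∃ F ∈ sphericalHarmonic k, f = F := by
  obtain ⟨P, hP, hPl, hfP⟩ := hf
  refine ⟨_, mem_sphericalHarmonic.2 ⟨P, mem_harmonicSubmodule.2 ⟨hP, ?_⟩, rfl⟩, ?_⟩
  · rwa [polyLaplacian_apply]
  · ext x
    rw [sphereRestrict_apply, hfP]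

lemma eLpNorm_eq_sqrt_sphereNormSq (f : C(S2, ℂ)) :
    eLpNorm f 2 sphereMeasure = ENNReal.ofReal √(sphereNormSq f) := by
  rw [sphereNormSq, Real.sqrt_sq (norm_nonneg _), ofReal_norm, Lp.enorm_def]
  exact eLpNorm_congr_ae (ContinuousMap.coeFn_toLp sphereMeasure f).symm

lemma eLpNorm_mul_le {k l : ℕ} {f g : S2 → ℂ}
    (hf : IsSphericalHarmonic k f) (hg : IsSphericalHarmonic l g) :
    eLpNorm (f * g) 2 sphereMeasure ≤
      ENNReal.ofReal (√(80 / sphereArea) * (1 + (k : ℝ)) ^ ((1 : ℝ) / 4)) *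
        eLpNorm f 2 sphereMeasure * eLpNorm g 2 sphereMeasure := by
  obtain ⟨F, hF, rfl⟩ := hf.exists_continuousMap
  obtain ⟨G, hG, rfl⟩ := hg.exists_continuousMap
  rw [← ContinuousMap.coe_mul, eLpNorm_eq_sqrt_sphereNormSq, eLpNorm_eq_sqrt_sphereNormSq,
    eLpNorm_eq_sqrt_sphereNormSq, ← ENNReal.ofReal_mul (by positivity),
    ← ENNReal.ofReal_mul (by positivity)]
  refine ENNReal.ofReal_le_ofReal ((Real.sqrt_le_sqrt (sphereNormSq_mul_le hF hG)).trans_eq ?_)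
  have hs := sphereArea_pos
  have hf0 := sphereNormSq_nonneg F
  have h1 : √√(1 + k) = (1 + (k : ℝ)) ^ ((1 : ℝ) / 4) := by
    rw [Real.sqrt_eq_rpow, Real.sqrt_eq_rpow, ← Real.rpow_mul (by positivity)]
    norm_num
  rw [← h1, ← Real.sqrt_mul (by positivity), ← Real.sqrt_mul (by positivity),
    ← Real.sqrt_mul (by positivity)]
  congr 1
  ring

/-- Bilinear estimate of Burq–Gérard–Tzvetkov: for spherical harmonics `f ∈ ℋ_{k₁}`,
`g ∈ ℋ_{k₂}` one has `‖fg‖_{L²(S²)} ≤ C min(1+k₁, 1+k₂)^{1/4} ‖f‖_{L²} ‖g‖_{L²}`. -/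
theorem bilinear_burq_gerard_tzvetkov :
    ∃ C : ℝ, 0 < C ∧ ∀ (k₁ k₂ : ℕ) (f g : sphere (0 : EuclideanSpace ℝ (Fin 3)) 1 → ℂ),
      IsSphericalHarmonic k₁ f → IsSphericalHarmonic k₂ g →
      eLpNorm (f * g) 2 sphereMeasure ≤
        ENNReal.ofReal (C * min (1 + (k₁ : ℝ)) (1 + (k₂ : ℝ)) ^ ((1 : ℝ) / 4)) *
          eLpNorm f 2 sphereMeasure * eLpNorm g 2 sphereMeasure := by
  have hs := sphereArea_pos
  refine ⟨√(80 / sphereArea), by positivity, fun k l f g hf hg => ?_⟩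
  rcases le_total k l with h | h
  · rw [min_eq_left (by gcongr)]
    exact eLpNorm_mul_le hf hg
  · rw [min_eq_right (by gcongr), mul_comm f, mul_right_comm]
    exact eLpNorm_mul_le hg hf
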